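/- arXiv:1004.1096 — 3 statements merged into one kernel-verified Lean document; each statement's English description precedes it below -/
import Mathlib

section
/- Let v: ℝⁿ×(0,∞) → (0,∞) be a smooth solution of the rescaled equation v_τ = ∇_y·(v (∇_y K_s v + β y)) such that v(·,τ) and v_τ(·,τ) belong to the Schwartz class for every τ, with locally uniform bounds. Then for every τ > 0 the first energy identity holds: d/dτ ∫_{ℝⁿ} v(y,τ) log v(y,τ) dy = −∫_{ℝⁿ} |∇H_s v|² dy + α ∫_{ℝⁿ} v dy. -/
open MeasureTheory Real Set Filter
open scoped RealInnerProductSpace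

noncomputable section

/-- Euclidean space ℝⁿ. -/
abbrev Spc (n : ℕ) := EuclideanSpace ℝ (Fin n)

/-- The Riesz constant `c(n,s) = Γ((n−2s)/2)/(4^s π^{n/2} Γ(s))`. -/
def rieszConst (n : ℕ) (s : ℝ) : ℝ :=
  Real.Gamma (((n : ℝ) - 2 * s) / 2) / (4 ^ s * Real.pi ^ ((n : ℝ) / 2) * Real.Gamma s)

/-- The inverse fractional Laplacian `K_s = (−Δ)^{−s}`, realized as convolution with
the Riesz kernel `c(n,s)|x|^{2s−n}`. -/
def Ks (n : ℕ) (s : ℝ) (u : Spc n → ℝ) (x : Spc n) : ℝ :=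
  rieszConst n s * ∫ y : Spc n, ‖x - y‖ ^ (2 * s - (n : ℝ)) * u y

/-- `H_s = K_s^{1/2} = (−Δ)^{−s/2}`, convolution with the Riesz kernel of order `s/2`. -/
def Hs (n : ℕ) (s : ℝ) (u : Spc n → ℝ) : Spc n → ℝ := Ks n (s / 2) u

/-- The flux field `v(∇K_s v + βy)` of the rescaled Fokker–Planck equation. -/
def fpField (n : ℕ) (s β : ℝ) (v : Spc n → ℝ) (y : Spc n) : Spc n :=
  v y • (gradient (Ks n s v) y + β • y)

/-- `v` is a classical (pointwise) solution of `v_τ = ∇_y·(v(∇_y K_s v + βy))`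
on `ℝⁿ × (0,∞)`, the divergence being the sum of the partial derivatives of the
components of the flux field. -/
def SolvesFP (n : ℕ) (s β : ℝ) (v : ℝ → Spc n → ℝ) : Prop :=
  ∀ τ : ℝ, 0 < τ → ∀ y : Spc n,
    deriv (fun σ => v σ y) τ =
      ∑ i : Fin n, fderiv ℝ (fun z : Spc n => fpField n s β (v τ) z i) y
        (EuclideanSpace.single i (1 : ℝ))

/-- Schwartz-class regularity of the solution and its time derivative, with locally
uniform bounds on all Schwartz seminorms. -/
def SchwartzInTime (n : ℕ) (v : ℝ → Spc n → ℝ) : Prop :=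
  ∃ F G : ℝ → SchwartzMap (Spc n) ℝ,
    (∀ τ : ℝ, 0 < τ → ∀ y : Spc n, F τ y = v τ y) ∧
    (∀ τ : ℝ, 0 < τ → ∀ y : Spc n, G τ y = deriv (fun σ => v σ y) τ) ∧
    (∀ k l : ℕ, ∀ a b : ℝ, 0 < a → ∃ M : ℝ, ∀ τ ∈ Set.Icc a b,
      SchwartzMap.seminorm ℝ k l (F τ) ≤ M ∧ SchwartzMap.seminorm ℝ k l (G τ) ≤ M)

lemma rieszConst_pos {n : ℕ} {s : ℝ} (hs : 0 < s) (hns : 2 * s < n) : 0 < rieszConst n s := by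
  have := Real.Gamma_pos_of_pos (show 0 < ((n : ℝ) - 2 * s) / 2 by linarith)
  have := Real.Gamma_pos_of_pos hs
  unfold rieszConst
  positivity

/-- The heat kernel `(4πt)^{-n/2} exp(-|x|²/4t)` on `ℝⁿ`. -/
def heatKernel (n : ℕ) (t : ℝ) (x : Spc n) : ℝ :=
  (4 * π * t) ^ (-((n : ℝ) / 2)) * rexp (-(1 / (4 * t)) * ‖x‖ ^ 2)

lemma measurable_heatKernel {n : ℕ} : Measurable (fun p : ℝ × Spc n => heatKernel n p.1 p.2) := by
  unfold heatKernel
  fun_prop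

lemma heatKernel_nonneg {n : ℕ} {t : ℝ} (ht : 0 < t) (x : Spc n) : 0 ≤ heatKernel n t x := by
  unfold heatKernel
  positivity

lemma heatKernel_mul {n : ℕ} {t r : ℝ} (ht : 0 < t) (hr : 0 < r) (x y z : Spc n) :
    heatKernel n t (x - z) * heatKernel n r (z - y) =
      (4 * π * t) ^ (-((n : ℝ) / 2)) * (4 * π * r) ^ (-((n : ℝ) / 2)) *
        rexp (-(1 / (4 * (t + r))) * ‖x - y‖ ^ 2) *
        rexp (-((t + r) / (4 * t * r)) * ‖z - (t + r)⁻¹ • (r • x + t • y)‖ ^ 2) := by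
  unfold heatKernel
  have hm : z - (t + r)⁻¹ • (r • x + t • y)
      = (t + r)⁻¹ • (t • (z - y) - r • (x - z)) := by
    have : z = (t + r)⁻¹ • ((t + r) • z) := by
      rw [smul_smul, inv_mul_cancel₀ (by positivity), one_smul]
    nth_rewrite 1 [this]
    module
  have hxy : x - y = (x - z) + (z - y) := by abel
  have hexp : -(1 / (4 * t)) * ‖x - z‖ ^ 2 + -(1 / (4 * r)) * ‖z - y‖ ^ 2 =
      -(1 / (4 * (t + r))) * ‖x - y‖ ^ 2 +
        -((t + r) / (4 * t * r)) * ‖z - (t + r)⁻¹ • (r • x + t • y)‖ ^ 2 := by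
    rw [hm, hxy]
    generalize x - z = p, z - y = q
    rw [norm_smul, mul_pow, norm_sub_sq_real, norm_add_sq_real, norm_smul, norm_smul,
      real_inner_smul_left, real_inner_smul_right, real_inner_comm q p]
    simp only [Real.norm_eq_abs, mul_pow, sq_abs]
    field_simp
    ring
  rw [mul_assoc _ _ (rexp _), ← Real.exp_add, ← hexp, Real.exp_add]
  ring

/-- Semigroup property of the heat kernel. -/
lemma lintegral_heatKernel_mul {n : ℕ} {t r : ℝ} (ht : 0 < t) (hr : 0 < r) (x y : Spc n) :
    ∫⁻ z, ENNReal.ofReal (heatKernel n t (x - z) * heatKernel n r (z - y)) =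
      ENNReal.ofReal (heatKernel n (t + r) (x - y)) := by
  have hb : 0 < (t + r) / (4 * t * r) := by positivity
  have hG : ∫ z : Spc n, rexp (-((t + r) / (4 * t * r)) *
      ‖z - (t + r)⁻¹ • (r • x + t • y)‖ ^ 2) = (π / ((t + r) / (4 * t * r))) ^ ((n : ℝ) / 2) := by
    rw [integral_sub_right_eq_self (fun z : Spc n => rexp (-((t + r) / (4 * t * r)) * ‖z‖ ^ 2)),
      GaussianFourier.integral_rexp_neg_mul_sq_norm hb]
    simp
  have hI : ∫ z, heatKernel n t (x - z) * heatKernel n r (z - y) =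
      heatKernel n (t + r) (x - y) := by
    simp_rw [heatKernel_mul ht hr]
    rw [integral_const_mul, hG, heatKernel]
    have : (4 * π * t) ^ (-((n : ℝ) / 2)) * (4 * π * r) ^ (-((n : ℝ) / 2)) *
        (π / ((t + r) / (4 * t * r))) ^ ((n : ℝ) / 2) = (4 * π * (t + r)) ^ (-((n : ℝ) / 2)) := by
      rw [Real.rpow_neg (by positivity), Real.rpow_neg (by positivity),
        Real.rpow_neg (by positivity), ← Real.inv_rpow (by positivity),
        ← Real.inv_rpow (by positivity), ← Real.inv_rpow (by positivity),
        ← Real.mul_rpow (by positivity) (by positivity),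
        ← Real.mul_rpow (by positivity) (by positivity)]
      congr 1
      field_simp
      try ring
    rw [← this]
    ring
  have hpos : 0 < heatKernel n (t + r) (x - y) := by unfold heatKernel; positivity
  rw [← hI, ofReal_integral_eq_lintegral_ofReal]
  · exact Integrable.of_integral_ne_zero (by rw [hI]; exact hpos.ne')
  · exact .of_forall fun z => mul_nonneg (heatKernel_nonneg ht _) (heatKernel_nonneg hr _)

/-- The Riesz kernel is a superposition of heat kernels. -/
lemma lintegral_rpow_mul_heatKernel {n : ℕ} {s : ℝ} (hs : 0 < s) (hns : 2 * s < n) {x : Spc n}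
    (hx : x ≠ 0) :
    ∫⁻ t in Ioi 0, ENNReal.ofReal (t ^ (s - 1) / Gamma s * heatKernel n t x) =
      ENNReal.ofReal (rieszConst n s * ‖x‖ ^ (2 * s - (n : ℝ))) := by
  have hx0 : 0 < ‖x‖ := norm_pos_iff.2 hx
  have hΓ := Real.Gamma_pos_of_pos hs
  have ha : 0 < (n : ℝ) / 2 - s := by linarith
  have hΓa := Real.Gamma_pos_of_pos ha
  have h1 := Real.integral_rpow_mul_exp_neg_mul_Ioi ha (r := ‖x‖ ^ 2 / 4) (by positivity)
  rw [← integral_comp_rpow_Ioi _ (p := -1) (by norm_num)] at h1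
  have hI : ∫ t in Ioi 0, t ^ (s - 1) / Gamma s * heatKernel n t x =
      rieszConst n s * ‖x‖ ^ (2 * s - (n : ℝ)) := by
    have h2 : ∀ t ∈ Ioi (0 : ℝ), t ^ (s - 1) / Gamma s * heatKernel n t x =
        ((4 * π) ^ (-((n : ℝ) / 2)) / Gamma s) * ((|(-1 : ℝ)| * t ^ ((-1 : ℝ) - 1)) •
          ((t ^ (-1 : ℝ)) ^ ((n : ℝ) / 2 - s - 1) * rexp (-(‖x‖ ^ 2 / 4 * t ^ (-1 : ℝ))))) := by
      intro t ht
      have ht : 0 < t := ht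
      rw [heatKernel, Real.mul_rpow (by positivity) ht.le, ← Real.rpow_mul ht.le, smul_eq_mul,
        abs_neg, abs_one, one_mul, Real.rpow_neg_one t]
      have e1 : -(1 / (4 * t)) * ‖x‖ ^ 2 = -(‖x‖ ^ 2 / 4 * t⁻¹) := by field_simp
      have e2 : t ^ (s - 1) * t ^ (-((n : ℝ) / 2)) =
          t ^ ((-1 : ℝ) - 1) * t ^ (-1 * ((n : ℝ) / 2 - s - 1)) := by
        rw [← Real.rpow_add ht, ← Real.rpow_add ht]
        congr 1
        ring
      rw [e1]
      linear_combination ((4 * π) ^ (-((n : ℝ) / 2)) / Gamma s * rexp (-(‖x‖ ^ 2 / 4 * t⁻¹))) * e2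
    rw [setIntegral_congr_fun measurableSet_Ioi h2, integral_const_mul, h1, rieszConst]
    have e3 : (1 / (‖x‖ ^ 2 / 4)) ^ ((n : ℝ) / 2 - s) =
        4 ^ ((n : ℝ) / 2) / 4 ^ s * ‖x‖ ^ (2 * s - (n : ℝ)) := by
      rw [one_div_div, Real.div_rpow (by norm_num) (by positivity), Real.rpow_sub (by norm_num),
        ← Real.rpow_natCast, ← Real.rpow_mul hx0.le, div_eq_mul_inv _ (‖x‖ ^ _),
        ← Real.rpow_neg hx0.le]
      congr 2
      push_cast
      ring
    have e4 : (4 * π) ^ (-((n : ℝ) / 2)) = (4 ^ ((n : ℝ) / 2) * π ^ ((n : ℝ) / 2))⁻¹ := by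
      rw [Real.rpow_neg (by positivity), Real.mul_rpow (by norm_num) Real.pi_pos.le]
    rw [e3, e4, show ((n : ℝ) - 2 * s) / 2 = (n : ℝ) / 2 - s by ring]
    field_simp
  have hc := rieszConst_pos hs hns
  rw [← hI, ofReal_integral_eq_lintegral_ofReal]
  · refine Integrable.of_integral_ne_zero ?_
    rw [hI]
    positivity
  · refine (ae_restrict_iff' measurableSet_Ioi).2 (.of_forall fun t ht => ?_)
    have ht : 0 < t := ht
    exact mul_nonneg (by positivity) (heatKernel_nonneg ht _)

/-- Convolution of two equal powers on the half-line, in terms of the Beta function. -/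
lemma lintegral_rpow_sub_rpow {a : ℝ} (ha : 0 < a) {T : ℝ} (hT : 0 < T) :
    ∫⁻ t in Ioo 0 T, ENNReal.ofReal (t ^ (a - 1) * (T - t) ^ (a - 1)) =
      ENNReal.ofReal (ProbabilityTheory.beta a a * T ^ (2 * a - 1)) := by
  have hB := ProbabilityTheory.beta_pos ha ha
  have hmap : (∫⁻ u, ProbabilityTheory.betaPDF a a u) =
      ∫⁻ t, ENNReal.ofReal T⁻¹ * ProbabilityTheory.betaPDF a a (T⁻¹ * t) := by
    have hm : Measurable (ProbabilityTheory.betaPDF a a) :=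
      (ProbabilityTheory.measurable_betaPDFReal a a).ennreal_ofReal
    rw [lintegral_const_mul' _ _ ENNReal.ofReal_ne_top,
      ← lintegral_map hm (measurable_const_mul _),
      Real.map_volume_mul_left (inv_ne_zero hT.ne'), lintegral_smul_measure, smul_eq_mul,
      ← mul_assoc, inv_inv, abs_of_pos hT, ← ENNReal.ofReal_mul (by positivity),
      inv_mul_cancel₀ hT.ne', ENNReal.ofReal_one, one_mul]
  rw [ProbabilityTheory.lintegral_betaPDF_eq_one ha ha] at hmap
  rw [← mul_one (ENNReal.ofReal _), hmap, ← lintegral_const_mul _ (by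
    exact ((ProbabilityTheory.measurable_betaPDFReal a a).comp
      (measurable_const_mul _)).ennreal_ofReal.const_mul _),
    ← lintegral_indicator measurableSet_Ioo]
  refine lintegral_congr fun t => ?_
  have hiff : (0 < T⁻¹ * t ∧ T⁻¹ * t < 1) ↔ t ∈ Ioo 0 T := by
    rw [inv_mul_lt_one₀ hT, mul_pos_iff_of_pos_left (inv_pos.2 hT), mem_Ioo]
  rw [ProbabilityTheory.betaPDF_eq, ← ENNReal.ofReal_mul (by positivity),
    ← ENNReal.ofReal_mul (by positivity)]
  by_cases ht : t ∈ Ioo 0 T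
  · rw [indicator_of_mem ht, if_pos (hiff.2 ht)]
    obtain ⟨h0, h1⟩ := ht
    congr 1
    have e : 1 - T⁻¹ * t = T⁻¹ * (T - t) := by field_simp
    rw [e, Real.mul_rpow (by positivity) h0.le, Real.mul_rpow (by positivity) (by linarith),
      Real.inv_rpow hT.le, show 2 * a - 1 = (a - 1) + (a - 1) + 1 by ring, Real.rpow_add hT,
      Real.rpow_add hT, Real.rpow_one]
    field_simp
  · rw [indicator_of_notMem ht, if_neg (fun h => ht (hiff.1 h)), mul_zero, mul_zero,
      ENNReal.ofReal_zero]

lemma lintegral_lintegral_rpow_mul_comp_add {a : ℝ} (ha : 0 < a) {g : ℝ → ENNReal}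
    (hg : Measurable g) :
    ∫⁻ t in Ioi 0, ∫⁻ r in Ioi 0, ENNReal.ofReal (t ^ (a - 1) * r ^ (a - 1)) * g (t + r) =
      ∫⁻ T in Ioi 0, ENNReal.ofReal (ProbabilityTheory.beta a a * T ^ (2 * a - 1)) * g T := by
  set w : ℝ → ENNReal := (Ioi 0).indicator fun r => ENNReal.ofReal (r ^ (a - 1)) with hw
  have hwm : Measurable w := Measurable.indicator (by fun_prop) measurableSet_Ioi
  have hwI (t : ℝ) (h : ℝ → ENNReal) :
      w t * h t = (Ioi 0).indicator (fun r => ENNReal.ofReal (r ^ (a - 1)) * h r) t := by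
    by_cases ht : t ∈ Ioi 0 <;> simp [hw, ht]
  have h1 : ∫⁻ t in Ioi 0, ∫⁻ r in Ioi 0, ENNReal.ofReal (t ^ (a - 1) * r ^ (a - 1)) * g (t + r) =
      ∫⁻ t, ∫⁻ T, w t * (w (T - t) * g T) := by
    rw [← lintegral_indicator measurableSet_Ioi]
    refine lintegral_congr fun t => ?_
    rw [lintegral_const_mul _ (by fun_prop), hwI t fun t => ∫⁻ T, w (T - t) * g T]
    by_cases ht : t ∈ Ioi 0
    · have ht' : 0 < t := ht
      rw [indicator_of_mem ht, indicator_of_mem ht]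
      have : ∫⁻ T, w (T - t) * g T = ∫⁻ r, w r * g (t + r) := by
        rw [← lintegral_add_right_eq_self (fun T => w (T - t) * g T) t]
        simp [add_comm]
      rw [this]
      simp_rw [hwI _ fun r => g (t + r)]
      rw [lintegral_indicator measurableSet_Ioi, ← lintegral_const_mul _ (by fun_prop)]
      refine lintegral_congr fun r => ?_
      rw [ENNReal.ofReal_mul (by positivity), mul_assoc]
    · rw [indicator_of_notMem ht, indicator_of_notMem ht]
  rw [h1, lintegral_lintegral_swap (by fun_prop), ← lintegral_indicator measurableSet_Ioi]
  refine lintegral_congr fun T => ?_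
  have h2 : ∀ t, w t * (w (T - t) * g T) = (Ioo 0 T).indicator
      (fun t => ENNReal.ofReal (t ^ (a - 1) * (T - t) ^ (a - 1))) t * g T := by
    intro t
    by_cases ht : t ∈ Ioo 0 T
    · rw [indicator_of_mem ht, hw, indicator_of_mem (by exact ht.1),
        indicator_of_mem (by simpa using ht.2), ENNReal.ofReal_mul (Real.rpow_nonneg ht.1.le _),
        mul_assoc]
    · rw [indicator_of_notMem ht, zero_mul]
      by_cases h0 : 0 < t
      · have : T - t ∉ Ioi 0 := by
          intro h
          exact ht ⟨h0, by simpa using h⟩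
        rw [hw, indicator_of_notMem this, zero_mul, mul_zero]
      · rw [hw, indicator_of_notMem (by simpa using h0), zero_mul]
  simp_rw [h2]
  rw [lintegral_mul_const _ (Measurable.indicator (by fun_prop) measurableSet_Ioo),
    lintegral_indicator measurableSet_Ioo]
  by_cases hT : 0 < T
  · rw [lintegral_rpow_sub_rpow ha hT, indicator_of_mem (by exact hT)]
  · rw [indicator_of_notMem (by simpa using hT), Ioo_eq_empty hT]
    simp

/-- The Riesz kernel of order `s`, i.e. the kernel of `(-Δ)^{-s}`. -/
def rieszKernel (n : ℕ) (s : ℝ) (x : Spc n) : ℝ :=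
  rieszConst n s * ‖x‖ ^ (2 * s - (n : ℝ))

lemma measurable_rieszKernel {n : ℕ} {s : ℝ} : Measurable (rieszKernel n s) := by
  unfold rieszKernel
  fun_prop

lemma rieszKernel_nonneg {n : ℕ} {s : ℝ} (hs : 0 < s) (hns : 2 * s < n) (x : Spc n) :
    0 ≤ rieszKernel n s x := by
  have := rieszConst_pos hs hns
  unfold rieszKernel
  positivity

lemma rieszKernel_sub_comm {n : ℕ} {s : ℝ} (x y : Spc n) :
    rieszKernel n s (x - y) = rieszKernel n s (y - x) := by
  rw [rieszKernel, rieszKernel, norm_sub_rev]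

lemma Ks_eq_integral_rieszKernel {n : ℕ} {s : ℝ} (u : Spc n → ℝ) (x : Spc n) :
    Ks n s u x = ∫ y, rieszKernel n s (x - y) * u y := by
  simp_rw [Ks, rieszKernel, mul_assoc]
  rw [integral_const_mul]

/-- The Riesz composition formula `(-Δ)^{-a/2} (-Δ)^{-a/2} = (-Δ)^{-a}` for the kernels. -/
lemma lintegral_rieszKernel_mul {n : ℕ} (hn : 1 ≤ n) {a : ℝ} (ha : 0 < a)
    (hna : 2 * (2 * a) < n) {x y : Spc n} (hxy : x ≠ y) :
    ∫⁻ z, ENNReal.ofReal (rieszKernel n a (x - z)) * ENNReal.ofReal (rieszKernel n a (z - y)) =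
      ENNReal.ofReal (rieszKernel n (2 * a) (x - y)) := by
  have : Nonempty (Fin n) := ⟨⟨0, hn⟩⟩
  have hΓ := Real.Gamma_pos_of_pos ha
  have hΓ2 := Real.Gamma_pos_of_pos (show 0 < 2 * a by linarith)
  have hna' : 2 * a < n := by linarith
  obtain ⟨H, hH⟩ : ∃ H : ℝ → Spc n → ENNReal, ∀ t w,
      H t w = ENNReal.ofReal (t ^ (a - 1) / Gamma a * heatKernel n t w) := ⟨_, fun _ _ => rfl⟩
  have hHm : Measurable (fun p : ℝ × Spc n => H p.1 p.2) := by
    have := @measurable_heatKernel n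
    simp_rw [hH]
    fun_prop
  have hHx : Measurable fun p : Spc n × ℝ => H p.2 (x - p.1) :=
    hHm.comp (measurable_snd.prodMk (measurable_const.sub measurable_fst))
  have hHy : Measurable fun p : Spc n × ℝ => H p.2 (p.1 - y) :=
    hHm.comp (measurable_snd.prodMk (measurable_fst.sub measurable_const))
  have hHx' (z : Spc n) : Measurable fun t => H t (x - z) := hHx.comp measurable_prodMk_left
  have hHy' (z : Spc n) : Measurable fun t => H t (z - y) := hHy.comp measurable_prodMk_left
  have h1 : ∫⁻ z, ENNReal.ofReal (rieszKernel n a (x - z)) *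
      ENNReal.ofReal (rieszKernel n a (z - y)) =
      ∫⁻ z, ∫⁻ t in Ioi 0, ∫⁻ r in Ioi 0, H t (x - z) * H r (z - y) := by
    refine lintegral_congr_ae ?_
    filter_upwards [Measure.ae_ne volume x, Measure.ae_ne volume y] with z hx hy
    rw [rieszKernel, rieszKernel, ← lintegral_rpow_mul_heatKernel ha hna' (sub_ne_zero.2 hx.symm),
      ← lintegral_rpow_mul_heatKernel ha hna' (sub_ne_zero.2 hy)]
    simp_rw [← hH]
    rw [← lintegral_mul_const _ (hHx' z)]
    refine lintegral_congr fun t => ?_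
    rw [← lintegral_const_mul _ (hHy' z)]
  have h2 : ∫⁻ z, ∫⁻ t in Ioi 0, ∫⁻ r in Ioi 0, H t (x - z) * H r (z - y) =
      ∫⁻ t in Ioi 0, ∫⁻ r in Ioi 0, ∫⁻ z, H t (x - z) * H r (z - y) := by
    have hmeas : Measurable fun p : (Spc n × ℝ) × ℝ => H p.1.2 (x - p.1.1) * H p.2 (p.1.1 - y) :=
      (hHx.comp measurable_fst).mul
        (hHy.comp ((measurable_fst.comp measurable_fst).prodMk measurable_snd))
    rw [lintegral_lintegral_swap]
    · refine lintegral_congr fun t => ?_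
      rw [lintegral_lintegral_swap]
      exact (hmeas.comp ((measurable_fst.prodMk measurable_const).prodMk
        measurable_snd)).aemeasurable
    · exact hmeas.lintegral_prod_right.aemeasurable
  have h3 : ∀ t ∈ Ioi (0 : ℝ), ∫⁻ r in Ioi 0, ∫⁻ z, H t (x - z) * H r (z - y) =
      ∫⁻ r in Ioi 0, ENNReal.ofReal (t ^ (a - 1) * r ^ (a - 1)) *
        ENNReal.ofReal ((Gamma a)⁻¹ ^ 2 * heatKernel n (t + r) (x - y)) := by
    intro t ht
    refine setLIntegral_congr_fun measurableSet_Ioi fun r hr => ?_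
    have ht : 0 < t := ht
    have hr : 0 < r := hr
    have e : ∀ z, H t (x - z) * H r (z - y) =
        ENNReal.ofReal (t ^ (a - 1) * r ^ (a - 1) * (Gamma a)⁻¹ ^ 2) *
          ENNReal.ofReal (heatKernel n t (x - z) * heatKernel n r (z - y)) := by
      intro z
      have := heatKernel_nonneg ht (x - z)
      rw [hH, hH, ← ENNReal.ofReal_mul (by positivity), ← ENNReal.ofReal_mul (by positivity)]
      congr 1
      field_simp
    simp_rw [e]
    rw [lintegral_const_mul' _ _ ENNReal.ofReal_ne_top, lintegral_heatKernel_mul ht hr,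
      ← ENNReal.ofReal_mul (by positivity), ← ENNReal.ofReal_mul (by positivity), mul_assoc]
  have hgm : Measurable fun T => ENNReal.ofReal ((Gamma a)⁻¹ ^ 2 * heatKernel n T (x - y)) :=
    (((@measurable_heatKernel n).comp (measurable_id.prodMk measurable_const)).const_mul
      _).ennreal_ofReal
  rw [h1, h2, setLIntegral_congr_fun measurableSet_Ioi h3,
    lintegral_lintegral_rpow_mul_comp_add ha hgm, rieszKernel,
    ← lintegral_rpow_mul_heatKernel (by positivity) hna (sub_ne_zero.2 hxy)]
  refine setLIntegral_congr_fun measurableSet_Ioi fun T hT => ?_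
  have hT : 0 < T := hT
  have hB := ProbabilityTheory.beta_pos ha ha
  rw [← ENNReal.ofReal_mul (by positivity), ProbabilityTheory.beta, ← two_mul]
  congr 1
  field_simp

lemma integrable_inv_one_add_norm_pow {n : ℕ} :
    Integrable fun x : Spc n => ((1 + ‖x‖) ^ (n + 1))⁻¹ := by
  have h := integrable_one_add_norm (E := Spc n) (μ := volume) (r := n + 1) (by simp)
  refine h.congr (.of_forall fun x => ?_)
  have : (0 : ℝ) ≤ 1 + ‖x‖ := by positivity
  simp only [Real.rpow_neg this]
  norm_cast

lemma integrableOn_rieszKernel_ball {n : ℕ} (hn : 1 ≤ n) {s : ℝ} (hs : 0 < s) :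
    IntegrableOn (rieszKernel n s) (Metric.ball 0 1) := by
  have : Nonempty (Fin n) := ⟨⟨0, hn⟩⟩
  refine (integrableOn_fun_norm_addHaar (volume : Measure (Spc n))
    (f := fun r => rieszConst n s * r ^ (2 * s - (n : ℝ)))).2 ?_
  have h := ((intervalIntegral.integrableOn_Ioo_rpow_iff (s := 2 * s - 1) one_pos).2
    (by linarith)).const_mul (rieszConst n s)
  refine IntegrableOn.congr_fun (show IntegrableOn _ _ _ from h) (fun r hr => ?_) measurableSet_Ioo
  have hr : 0 < r := hr.1
  simp only [finrank_euclideanSpace, Fintype.card_fin, smul_eq_mul]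
  rw [show 2 * s - 1 = ((n - 1 : ℕ) : ℝ) + (2 * s - n) by push_cast [Nat.cast_sub hn]; ring,
    Real.rpow_add hr, Real.rpow_natCast]
  ring

/-- Riesz potentials of decaying functions converge, with a uniform bound. -/
lemma exists_integral_rieszKernel_le {n : ℕ} (hn : 1 ≤ n) {s : ℝ} (hs : 0 < s)
    (hns : 2 * s < n) : ∃ C : ℝ, 0 ≤ C ∧ ∀ x : Spc n,
      Integrable (fun y => rieszKernel n s (x - y) * ((1 + ‖y‖) ^ (n + 1))⁻¹) ∧
      ∫ y, rieszKernel n s (x - y) * ((1 + ‖y‖) ^ (n + 1))⁻¹ ≤ C := by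
  have hc := rieszConst_pos hs hns
  have hk := @rieszKernel_nonneg n s hs hns
  have hg : Integrable ((Metric.ball (0 : Spc n) 1).indicator (rieszKernel n s)) :=
    (integrable_indicator_iff measurableSet_ball).2 (integrableOn_rieszKernel_ball hn hs)
  have hw := (@integrable_inv_one_add_norm_pow n).const_mul (rieszConst n s)
  set g := (Metric.ball (0 : Spc n) 1).indicator (rieszKernel n s) with hgdef
  have hg0 : ∀ z, 0 ≤ g z := fun z => indicator_nonneg (fun z _ => hk z) z
  have hle : ∀ x y, rieszKernel n s (x - y) * ((1 + ‖y‖) ^ (n + 1))⁻¹ ≤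
      g (x - y) + rieszConst n s * ((1 + ‖y‖) ^ (n + 1))⁻¹ := by
    intro x y
    have hw0 : 0 ≤ ((1 + ‖y‖) ^ (n + 1))⁻¹ := by positivity
    by_cases h : x - y ∈ Metric.ball (0 : Spc n) 1
    · have hw1 : ((1 + ‖y‖) ^ (n + 1))⁻¹ ≤ 1 :=
        inv_le_one_of_one_le₀ (one_le_pow₀ (by linarith [norm_nonneg y]))
      rw [hgdef, indicator_of_mem h]
      nlinarith [mul_le_mul_of_nonneg_left hw1 (hk (x - y)), mul_nonneg hc.le hw0]
    · have h1 : rieszKernel n s (x - y) ≤ rieszConst n s := by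
        have h1 : 1 ≤ ‖x - y‖ := by simpa using h
        have := Real.rpow_le_one_of_one_le_of_nonpos h1 (show 2 * s - (n : ℝ) ≤ 0 by linarith)
        exact (mul_le_mul_of_nonneg_left this hc.le).trans_eq (mul_one _)
      have := mul_le_mul_of_nonneg_right h1 hw0
      linarith [hg0 (x - y)]
  have hsum (x : Spc n) : Integrable
      fun y => g (x - y) + rieszConst n s * ((1 + ‖y‖) ^ (n + 1))⁻¹ :=
    (hg.comp_sub_left x).add hw
  have hint (x : Spc n) :
      Integrable (fun y => rieszKernel n s (x - y) * ((1 + ‖y‖) ^ (n + 1))⁻¹) := by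
    refine (hsum x).mono' ?_ (.of_forall fun y => ?_)
    · have := @measurable_rieszKernel n s
      exact (by fun_prop : Measurable _).aestronglyMeasurable
    · rw [Real.norm_of_nonneg (mul_nonneg (hk _) (by positivity))]
      exact hle x y
  refine ⟨(∫ z, g z) + ∫ y : Spc n, rieszConst n s * ((1 + ‖y‖) ^ (n + 1))⁻¹, ?_,
    fun x => ⟨hint x, ?_⟩⟩
  · have h1 : 0 ≤ ∫ z, g z := integral_nonneg hg0
    have h2 : 0 ≤ ∫ y : Spc n, rieszConst n s * ((1 + ‖y‖) ^ (n + 1))⁻¹ :=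
      integral_nonneg fun y => by positivity
    positivity
  · refine (integral_mono (hint x) (hsum x) (hle x)).trans_eq ?_
    rw [integral_add (hg.comp_sub_left x) hw, integral_sub_left_eq_self g]

lemma integrable_rieszKernel_mul {n : ℕ} (hn : 1 ≤ n) {s : ℝ} (hs : 0 < s) (hns : 2 * s < n)
    {f : Spc n → ℝ} (hf : AEStronglyMeasurable f) {M : ℝ}
    (hM : ∀ x, |f x| ≤ M * ((1 + ‖x‖) ^ (n + 1))⁻¹) (x : Spc n) :
    Integrable fun y => rieszKernel n s (x - y) * f y := by
  obtain ⟨C, -, hC⟩ := exists_integral_rieszKernel_le hn hs hns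
  refine ((hC x).1.const_mul M).mono' ?_ (.of_forall fun y => ?_)
  · have := @measurable_rieszKernel n s
    exact (by fun_prop : Measurable fun y => rieszKernel n s (x - y)).aestronglyMeasurable.mul hf
  · have hk := rieszKernel_nonneg hs hns (x - y)
    rw [norm_mul, Real.norm_of_nonneg hk, Real.norm_eq_abs]
    calc _ ≤ rieszKernel n s (x - y) * (M * ((1 + ‖y‖) ^ (n + 1))⁻¹) := by gcongr; exact hM y
      _ = _ := by ring

/-- Sup bound for Riesz potentials of decaying functions. -/
lemma exists_abs_Ks_le {n : ℕ} (hn : 1 ≤ n) {s : ℝ} (hs : 0 < s) (hns : 2 * s < n) :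
    ∃ C : ℝ, 0 ≤ C ∧ ∀ (f : Spc n → ℝ) (M : ℝ), (∀ x, |f x| ≤ M * ((1 + ‖x‖) ^ (n + 1))⁻¹) →
      ∀ x, ∫ y, rieszKernel n s (x - y) * |f y| ≤ C * M ∧ |Ks n s f x| ≤ C * M := by
  obtain ⟨C, hC0, hC⟩ := exists_integral_rieszKernel_le hn hs hns
  refine ⟨C, hC0, fun f M hM x => ?_⟩
  have hM0 : 0 ≤ M := by
    have := (abs_nonneg _).trans (hM 0)
    simpa using this
  have hk := rieszKernel_nonneg hs hns
  have hle : ∀ y, rieszKernel n s (x - y) * |f y| ≤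
      M * (rieszKernel n s (x - y) * ((1 + ‖y‖) ^ (n + 1))⁻¹) := fun y => by
    calc _ ≤ rieszKernel n s (x - y) * (M * ((1 + ‖y‖) ^ (n + 1))⁻¹) := by
          gcongr
          exacts [hk _, hM y]
      _ = _ := by ring
  have h1 : ∫ y, rieszKernel n s (x - y) * |f y| ≤ C * M := by
    calc _ ≤ ∫ y, M * (rieszKernel n s (x - y) * ((1 + ‖y‖) ^ (n + 1))⁻¹) :=
          integral_mono_of_nonneg (.of_forall fun y => mul_nonneg (hk _) (abs_nonneg _))
            ((hC x).1.const_mul M) (.of_forall hle)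
      _ ≤ M * C := by
          rw [integral_const_mul]
          gcongr
          exact (hC x).2
      _ = _ := mul_comm _ _
  refine ⟨h1, ?_⟩
  rw [Ks_eq_integral_rieszKernel]
  refine (abs_integral_le_integral_abs).trans ?_
  simpa only [abs_mul, abs_of_nonneg (hk _)] using h1

lemma ae_fst_ne_snd {n : ℕ} (hn : 1 ≤ n) :
    ∀ᵐ p : Spc n × Spc n ∂(volume.prod volume), p.1 ≠ p.2 := by
  have : Nonempty (Fin n) := ⟨⟨0, hn⟩⟩
  have hd : MeasurableSet {p : Spc n × Spc n | p.1 = p.2} :=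
    measurableSet_eq_fun measurable_fst measurable_snd
  have : (volume.prod volume) {p : Spc n × Spc n | p.1 = p.2} = 0 := by
    rw [Measure.measure_prod_null hd]
    refine .of_forall fun x => ?_
    have : Prod.mk x ⁻¹' {p : Spc n × Spc n | p.1 = p.2} = {x} := by
      ext y
      simp [eq_comm]
    change volume (Prod.mk x ⁻¹' {p : Spc n × Spc n | p.1 = p.2}) = 0
    rw [this]
    simp
  rw [ae_iff]
  simpa using this

/-- `∫ |(-Δ)^{-a/2} f|² = ∫ f (-Δ)^{-a} f`. -/
lemma integral_Ks_sq {n : ℕ} (hn : 1 ≤ n) {a : ℝ} (ha : 0 < a) (hna : 2 * (2 * a) < n)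
    {f : Spc n → ℝ} (hf : Continuous f) {M : ℝ}
    (hM : ∀ x, |f x| ≤ M * ((1 + ‖x‖) ^ (n + 1))⁻¹) :
    Integrable (fun z => Ks n a f z ^ 2) ∧
      ∫ z, Ks n a f z ^ 2 = ∫ x, f x * Ks n (2 * a) f x := by
  have ha2 : 0 < 2 * a := by linarith
  have hk := @rieszKernel_nonneg n a ha (by linarith)
  have hK := @rieszKernel_nonneg n (2 * a) ha2 hna
  have hkm := @measurable_rieszKernel n a
  have hKm := @measurable_rieszKernel n (2 * a)
  have hfm := hf.measurable
  obtain ⟨C, hC0, hC⟩ := exists_abs_Ks_le hn ha2 hna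
  have hfint : Integrable f := (integrable_inv_one_add_norm_pow.const_mul M).mono'
    hf.aestronglyMeasurable (.of_forall hM)
  obtain ⟨Ψ, hΨ⟩ : ∃ Ψ : Spc n × Spc n → ℝ,
      ∀ p, Ψ p = f p.1 * (rieszKernel n (2 * a) (p.1 - p.2) * f p.2) := ⟨_, fun _ => rfl⟩
  obtain ⟨Φ, hΦ⟩ : ∃ Φ : Spc n × (Spc n × Spc n) → ℝ, ∀ q, Φ q =
      (rieszKernel n a (q.1 - q.2.1) * f q.2.1) * (rieszKernel n a (q.1 - q.2.2) * f q.2.2) :=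
    ⟨_, fun _ => rfl⟩
  have hΨm : Measurable Ψ := by
    rw [show Ψ = _ from funext hΨ]
    fun_prop
  have hΦm : Measurable Φ := by
    rw [show Φ = _ from funext hΦ]
    fun_prop
  have hΨint : Integrable Ψ (volume.prod volume) := by
    rw [integrable_prod_iff hΨm.aestronglyMeasurable]
    constructor
    · refine .of_forall fun x => ?_
      simp_rw [hΨ]
      exact (integrable_rieszKernel_mul hn ha2 hna hf.aestronglyMeasurable hM x).const_mul _
    · refine (hfint.abs.mul_const (C * M)).mono'
        hΨm.aestronglyMeasurable.norm.integral_prod_right' (.of_forall fun x => ?_)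
      simp_rw [hΨ, norm_mul, Real.norm_of_nonneg (hK _), Real.norm_eq_abs]
      rw [integral_const_mul, abs_mul, abs_abs,
        abs_of_nonneg (integral_nonneg fun y => mul_nonneg (hK _) (abs_nonneg _))]
      exact mul_le_mul_of_nonneg_left (hC f M hM x).1 (abs_nonneg _)
  have hcomp : ∀ p : Spc n × Spc n, p.1 ≠ p.2 →
      ∫⁻ z, ENNReal.ofReal (rieszKernel n a (z - p.1) * rieszKernel n a (z - p.2)) =
        ENNReal.ofReal (rieszKernel n (2 * a) (p.1 - p.2)) := by
    intro p hp
    rw [← lintegral_rieszKernel_mul hn ha hna hp]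
    refine lintegral_congr fun z => ?_
    rw [rieszKernel_sub_comm z, ENNReal.ofReal_mul (hk _)]
  have hΦint : Integrable Φ (volume.prod (volume.prod volume)) := by
    refine ⟨hΦm.aestronglyMeasurable, ?_⟩
    rw [HasFiniteIntegral, lintegral_prod_symm _ hΦm.enorm.aemeasurable]
    refine lt_of_eq_of_lt (lintegral_congr_ae ?_) hΨint.2
    filter_upwards [ae_fst_ne_snd hn] with p hp
    have : ∀ z, ‖Φ (z, p)‖ₑ = ‖f p.1 * f p.2‖ₑ *
        ENNReal.ofReal (rieszKernel n a (z - p.1) * rieszKernel n a (z - p.2)) := by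
      intro z
      rw [← Real.enorm_of_nonneg (mul_nonneg (hk _) (hk _)), ← enorm_mul, hΦ]
      congr 1
      ring
    simp_rw [this]
    rw [lintegral_const_mul' _ _ enorm_ne_top, hcomp p hp, ← Real.enorm_of_nonneg (hK _),
      ← enorm_mul, hΨ]
    congr 1
    ring
  have hsq : ∀ z, ∫ p, Φ (z, p) ∂(volume.prod volume) = Ks n a f z ^ 2 := by
    intro z
    simp_rw [hΦ]
    rw [integral_prod_mul (fun x => rieszKernel n a (z - x) * f x)
      (fun x => rieszKernel n a (z - x) * f x), ← Ks_eq_integral_rieszKernel, sq]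
  refine ⟨hΦint.integral_prod_left.congr (.of_forall hsq), ?_⟩
  simp_rw [← hsq]
  rw [← integral_prod _ hΦint, integral_prod_symm _ hΦint]
  have h2 : ∫ p, (∫ z, Φ (z, p)) ∂(volume.prod volume) = ∫ p, Ψ p ∂(volume.prod volume) := by
    refine integral_congr_ae ?_
    filter_upwards [ae_fst_ne_snd hn] with p hp
    have : ∀ z, Φ (z, p) = (f p.1 * f p.2) *
        (rieszKernel n a (z - p.1) * rieszKernel n a (z - p.2)) := by
      intro z
      rw [hΦ]
      ring
    simp_rw [this]
    rw [integral_const_mul, integral_eq_lintegral_of_nonneg_ae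
      (.of_forall fun z => mul_nonneg (hk _) (hk _))
      (by fun_prop : Measurable _).aestronglyMeasurable, hcomp p hp,
      ENNReal.toReal_ofReal (hK _), hΨ]
    ring
  rw [h2, integral_prod _ hΨint]
  simp_rw [hΨ, integral_const_mul, ← Ks_eq_integral_rieszKernel]

section

open scoped SchwartzMap LineDeriv

/-- The directional derivative of a Schwartz function. -/
abbrev dirDeriv {n : ℕ} (m : Spc n) (f : 𝓢(Spc n, ℝ)) : 𝓢(Spc n, ℝ) := ∂_{m} f

/-- Boundedness of a set of Schwartz functions in every Schwartz seminorm. -/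
def SchwartzBounded {n : ℕ} (S : Set 𝓢(Spc n, ℝ)) : Prop :=
  ∀ k l : ℕ, ∃ M : ℝ, ∀ f ∈ S, SchwartzMap.seminorm ℝ k l f ≤ M

lemma SchwartzBounded.singleton {n : ℕ} (f : 𝓢(Spc n, ℝ)) : SchwartzBounded {f} :=
  fun k l => ⟨SchwartzMap.seminorm ℝ k l f, fun g hg => by rw [mem_singleton_iff.1 hg]⟩

lemma SchwartzBounded.finset_sup {n : ℕ} {S : Set 𝓢(Spc n, ℝ)} (hS : SchwartzBounded S)
    (A : Finset (ℕ × ℕ)) :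
    ∃ M : ℝ, 0 ≤ M ∧ ∀ f ∈ S, A.sup (schwartzSeminormFamily ℝ (Spc n) ℝ) f ≤ M := by
  choose M hM using hS
  have h0 : 0 ≤ ∑ m ∈ A, |M m.1 m.2| := Finset.sum_nonneg fun _ _ => abs_nonneg _
  refine ⟨_, h0, fun f hf => Seminorm.finset_sup_apply_le h0 fun m hm => ?_⟩
  exact ((hM m.1 m.2 f hf).trans (le_abs_self _)).trans
    (Finset.single_le_sum (f := fun m : ℕ × ℕ => |M m.1 m.2|) (fun _ _ => abs_nonneg _) hm)

lemma SchwartzBounded.exists_norm_iteratedFDeriv_le {n : ℕ} {S : Set 𝓢(Spc n, ℝ)}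
    (hS : SchwartzBounded S) (k l : ℕ) : ∃ M : ℝ, 0 ≤ M ∧ ∀ f ∈ S, ∀ x,
      ‖iteratedFDeriv ℝ l f x‖ ≤ M * ((1 + ‖x‖) ^ k)⁻¹ := by
  obtain ⟨M, hM0, hM⟩ := hS.finset_sup (Finset.Iic (k, l))
  refine ⟨2 ^ k * M, by positivity, fun f hf x => ?_⟩
  rw [← div_eq_mul_inv, le_div_iff₀ (by positivity), mul_comm]
  refine (SchwartzMap.one_add_le_sup_seminorm_apply (𝕜 := ℝ) (m := (k, l)) le_rfl le_rfl f x).trans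
    ?_
  gcongr
  exact hM f hf

lemma SchwartzBounded.exists_abs_le {n : ℕ} {S : Set 𝓢(Spc n, ℝ)} (hS : SchwartzBounded S)
    (k : ℕ) : ∃ M : ℝ, 0 ≤ M ∧ ∀ f ∈ S, ∀ x, |f x| ≤ M * ((1 + ‖x‖) ^ k)⁻¹ := by
  simpa using hS.exists_norm_iteratedFDeriv_le k 0

lemma SchwartzBounded.image_dirDeriv {n : ℕ} {S : Set 𝓢(Spc n, ℝ)} (hS : SchwartzBounded S)
    (m : Spc n) : SchwartzBounded (dirDeriv m '' S) := by
  intro k l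
  have hc : Continuous fun f : 𝓢(Spc n, ℝ) => SchwartzMap.seminorm ℝ k l (dirDeriv m f) :=
    ((schwartz_withSeminorms ℝ (Spc n) ℝ).continuous_seminorm (k, l)).comp
      (LineDeriv.lineDerivOpCLM ℝ 𝓢(Spc n, ℝ) m).continuous
  let q : Seminorm ℝ 𝓢(Spc n, ℝ) := (SchwartzMap.seminorm ℝ k l).comp
    (LineDeriv.lineDerivOpCLM ℝ 𝓢(Spc n, ℝ) m : 𝓢(Spc n, ℝ) →ₗ[ℝ] 𝓢(Spc n, ℝ))
  obtain ⟨A, C, -, hC⟩ := Seminorm.bound_of_continuous (schwartz_withSeminorms ℝ (Spc n) ℝ) q hc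
  obtain ⟨M, -, hM⟩ := hS.finset_sup A
  refine ⟨C * M, ?_⟩
  rintro _ ⟨f, hf, rfl⟩
  exact (hC f).trans (mul_le_mul_of_nonneg_left (hM f hf) C.2)

lemma hasFDerivAt_Ks {n : ℕ} (hn : 1 ≤ n) {s : ℝ} (hs : 0 < s) (hns : 2 * s < n)
    (f : 𝓢(Spc n, ℝ)) (x : Spc n) : ∃ L : Spc n →L[ℝ] ℝ,
      HasFDerivAt (Ks n s f) L x ∧ ∀ m, L m = Ks n s (dirDeriv m f) x := by
  obtain ⟨M, hM0, hM⟩ := (SchwartzBounded.singleton f).exists_norm_iteratedFDeriv_le (n + 1) 1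
  obtain ⟨N, -, hN⟩ := (SchwartzBounded.singleton f).exists_abs_le (n + 1)
  have hN := hN f rfl
  have hM : ∀ y, ‖fderiv ℝ f y‖ ≤ M * ((1 + ‖y‖) ^ (n + 1))⁻¹ := fun y => by
    simpa [norm_iteratedFDeriv_one] using hM f rfl y
  have hk := @rieszKernel_nonneg n s hs hns
  have hkm := @measurable_rieszKernel n s
  have hKs : ∀ (u : Spc n → ℝ) (x : Spc n), Ks n s u x = ∫ z, rieszKernel n s z * u (x - z) := by
    intro u x
    rw [Ks_eq_integral_rieszKernel,
      ← integral_sub_left_eq_self (fun z => rieszKernel n s z * u (x - z)) _ x]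
    simp
  have hfd : Continuous (fderiv ℝ f) := (f.smooth 1).continuous_fderiv (by norm_num)
  have hbdint : Integrable fun z =>
      (M * 2 ^ (n + 1)) * (rieszKernel n s z * ((1 + ‖x - z‖) ^ (n + 1))⁻¹) := by
    obtain ⟨C, -, hC⟩ := exists_integral_rieszKernel_le hn hs hns
    simpa using (((hC x).1.comp_sub_left x).const_mul (M * 2 ^ (n + 1)))
  have hbd : ∀ z, ∀ y ∈ Metric.ball x 1, ‖rieszKernel n s z • fderiv ℝ f (y - z)‖ ≤
      (M * 2 ^ (n + 1)) * (rieszKernel n s z * ((1 + ‖x - z‖) ^ (n + 1))⁻¹) := by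
    intro z y hy
    rw [norm_smul, Real.norm_of_nonneg (hk z)]
    have h1 : 1 + ‖x - z‖ ≤ 2 * (1 + ‖y - z‖) := by
      have h2 : ‖x - z‖ ≤ ‖y - z‖ + ‖y - x‖ := by
        have := norm_sub_le (y - z) (y - x)
        simpa using this
      have h3 : ‖y - x‖ < 1 := by simpa [dist_eq_norm] using hy
      linarith [norm_nonneg (y - z)]
    have h4 : ((1 + ‖y - z‖) ^ (n + 1))⁻¹ ≤ 2 ^ (n + 1) * ((1 + ‖x - z‖) ^ (n + 1))⁻¹ := by
      rw [← div_eq_mul_inv, inv_eq_one_div, div_le_div_iff₀ (by positivity) (by positivity),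
        ← mul_pow, one_mul]
      gcongr
    calc _ ≤ rieszKernel n s z * (M * ((1 + ‖y - z‖) ^ (n + 1))⁻¹) := by
          gcongr
          exacts [hk z, hM _]
      _ ≤ rieszKernel n s z * (M * (2 ^ (n + 1) * ((1 + ‖x - z‖) ^ (n + 1))⁻¹)) := by
          gcongr
          exact hk z
      _ = _ := by ring
  have hF'm : AEStronglyMeasurable fun z => rieszKernel n s z • fderiv ℝ f (x - z) :=
    hkm.aestronglyMeasurable.smul (hfd.comp (continuous_const.sub continuous_id)).aestronglyMeasurable
  have hder := hasFDerivAt_integral_of_dominated_of_fderiv_le (μ := volume)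
    (F := fun y z => rieszKernel n s z * f (y - z))
    (F' := fun y z => rieszKernel n s z • fderiv ℝ f (y - z)) (Metric.ball_mem_nhds x one_pos)
    (.of_forall fun y => (hkm.mul (by fun_prop)).aestronglyMeasurable)
    (by
      have := (integrable_rieszKernel_mul hn hs hns f.continuous.aestronglyMeasurable hN
        x).comp_sub_left x
      simpa using this)
    hF'm (.of_forall hbd) hbdint
    (.of_forall fun z y _ => by
      have h1 := (f.hasFDerivAt (y - z)).comp y ((hasFDerivAt_id y).sub_const z)
      exact h1.const_mul (rieszKernel n s z))
  refine ⟨_, hder.congr_of_eventuallyEq (.of_forall fun y => hKs f y), fun m => ?_⟩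
  have hint : Integrable fun z => rieszKernel n s z • fderiv ℝ f (x - z) :=
    hbdint.mono' hF'm (.of_forall fun z => hbd z x (Metric.mem_ball_self one_pos))
  rw [ContinuousLinearMap.integral_apply hint, hKs]
  rfl

lemma differentiable_Ks {n : ℕ} (hn : 1 ≤ n) {s : ℝ} (hs : 0 < s) (hns : 2 * s < n)
    (f : 𝓢(Spc n, ℝ)) : Differentiable ℝ (Ks n s f) := fun x =>
  let ⟨_, hL, _⟩ := hasFDerivAt_Ks hn hs hns f x
  hL.differentiableAt

lemma fderiv_Ks {n : ℕ} (hn : 1 ≤ n) {s : ℝ} (hs : 0 < s) (hns : 2 * s < n)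
    (f : 𝓢(Spc n, ℝ)) (x m : Spc n) : fderiv ℝ (Ks n s f) x m = Ks n s (dirDeriv m f) x := by
  obtain ⟨L, hL, hm⟩ := hasFDerivAt_Ks hn hs hns f x
  rw [hL.fderiv, hm]

lemma gradient_apply {n : ℕ} (u : Spc n → ℝ) (x : Spc n) (i : Fin n) :
    gradient u x i = fderiv ℝ u x (EuclideanSpace.single i 1) := by
  have h : ⟪gradient u x, EuclideanSpace.single i (1 : ℝ)⟫ =
      fderiv ℝ u x (EuclideanSpace.single i 1) := InnerProductSpace.toDual_symm_apply
  rw [← h, EuclideanSpace.inner_single_right]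
  simp

lemma gradient_Ks_apply {n : ℕ} (hn : 1 ≤ n) {s : ℝ} (hs : 0 < s) (hns : 2 * s < n)
    (f : 𝓢(Spc n, ℝ)) (x : Spc n) (i : Fin n) :
    gradient (Ks n s f) x i = Ks n s (dirDeriv (EuclideanSpace.single i 1) f) x := by
  rw [gradient_apply, fderiv_Ks hn hs hns]

/-- Glaeser's inequality in a fixed direction. -/
lemma lineDeriv_sq_le {n : ℕ} {f : 𝓢(Spc n, ℝ)} (hf : ∀ x, 0 ≤ f x) {m : Spc n} {M : ℝ}
    (hM : ∀ x, |dirDeriv m (dirDeriv m f) x| ≤ M) (x : Spc n) :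
    (dirDeriv m f x) ^ 2 ≤ 4 * M * f x := by
  have hM0 : 0 ≤ M := (abs_nonneg _).trans (hM 0)
  have hd : ∀ (g : 𝓢(Spc n, ℝ)) (t : ℝ),
      HasDerivAt (fun t : ℝ => g (x + t • m)) (dirDeriv m g (x + t • m)) t := by
    intro g t
    have h1 : HasDerivAt (fun t : ℝ => x + t • m) m t := by
      simpa using ((hasDerivAt_id t).smul_const m).const_add x
    exact (g.hasFDerivAt _).comp_hasDerivAt t h1
  have h1 : ∀ t : ℝ, |dirDeriv m f (x + t • m) - dirDeriv m f x| ≤ M * |t| := by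
    intro t
    have := convex_univ.norm_image_sub_le_of_norm_hasDerivWithin_le
      (fun t _ => (hd (dirDeriv m f) t).hasDerivWithinAt) (fun t _ => hM (x + t • m))
      (mem_univ (0 : ℝ)) (mem_univ t)
    simpa using this
  have h2 : ∀ t : ℝ, 0 ≤ M * (t * t) + dirDeriv m f x * t + f x := by
    intro t
    have := (convex_uIcc 0 t).norm_image_sub_le_of_norm_hasDerivWithin_le
      (f := fun r => f (x + r • m) - r * dirDeriv m f x) (C := M * |t|)
      (fun r _ => ((hd f r).sub ((hasDerivAt_id r).mul_const _)).hasDerivWithinAt)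
      (fun r hr => by
        rw [one_mul]
        refine (h1 r).trans (mul_le_mul_of_nonneg_left ?_ hM0)
        simpa using abs_sub_left_of_mem_uIcc hr)
      left_mem_uIcc right_mem_uIcc
    simp only [zero_smul, add_zero, zero_mul, sub_zero, Real.norm_eq_abs] at this
    have h3 := (abs_le.1 this).2
    have h4 := hf (x + t • m)
    have h5 : M * |t| * |t| = M * (t * t) := by rw [mul_assoc, abs_mul_abs_self]
    linarith
  have := discrim_le_zero h2
  rw [discrim] at this
  linarith

lemma exists_mul_abs_log_le (n : ℕ) {K : ℝ} (hK : 0 ≤ K) : ∃ C : ℝ, 0 ≤ C ∧ ∀ u r : ℝ, 0 ≤ r →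
    0 < u → u ≤ K * ((1 + r) ^ (4 * (n + 2)))⁻¹ →
      (1 + r) * (√u + u) * (|log u| + 1) ≤ C * ((1 + r) ^ (n + 1))⁻¹ := by
  set A := 1 + K with hA
  have hA1 : 1 ≤ A := by linarith
  refine ⟨A * (4 + A + 8 * A ^ 2 + A ^ 3 + 4 * A ^ 4), by positivity, fun u r hr hu huK => ?_⟩
  obtain ⟨w, hw0, rfl⟩ : ∃ w : ℝ, 0 < w ∧ w ^ 4 = u := by
    refine ⟨√√u, by positivity, ?_⟩
    rw [show √√u ^ 4 = (√√u ^ 2) ^ 2 by ring, Real.sq_sqrt (by positivity), Real.sq_sqrt hu.le]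
  have hsq : √(w ^ 4) = w ^ 2 := by
    rw [show w ^ 4 = (w ^ 2) ^ 2 by ring, Real.sqrt_sq (by positivity)]
  set d := ((1 + r) ^ (n + 2))⁻¹ with hd
  have hd0 : 0 < d := by positivity
  have hd1 : d ≤ 1 := inv_le_one_of_one_le₀ (one_le_pow₀ (by linarith))
  have hw : w ≤ A * d := by
    refine le_of_pow_le_pow_left₀ (n := 4) (by norm_num) (by positivity) (huK.trans ?_)
    rw [mul_pow, hd, inv_pow, ← pow_mul, mul_comm 4]
    gcongr
    calc K ≤ A := by linarith
      _ ≤ A ^ 4 := le_self_pow₀ hA1 (by norm_num)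
  have hwA : w ≤ A := hw.trans (mul_le_of_le_one_right (by linarith) hd1)
  have hlog : |log (w ^ 4)| ≤ 4 * (w + w⁻¹) := by
    have h1 := Real.log_le_sub_one_of_pos hw0
    have h2 := Real.log_le_sub_one_of_pos (inv_pos.2 hw0)
    rw [Real.log_inv] at h2
    have h3 := inv_pos.2 hw0
    rw [Real.log_pow, abs_mul]
    push_cast
    rw [abs_of_pos (by norm_num : (0 : ℝ) < 4)]
    gcongr
    exact abs_le.2 ⟨by linarith, by linarith⟩
  have hwd : (1 + r) * w ≤ A * ((1 + r) ^ (n + 1))⁻¹ := by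
    calc (1 + r) * w ≤ (1 + r) * (A * d) := by gcongr
      _ = A * ((1 + r) ^ (n + 1))⁻¹ := by rw [hd]; field_simp; ring
  rw [hsq]
  calc (1 + r) * (w ^ 2 + w ^ 4) * (|log (w ^ 4)| + 1)
      ≤ (1 + r) * (w ^ 2 + w ^ 4) * (4 * (w + w⁻¹) + 1) := by gcongr
    _ = ((1 + r) * w) * (4 + w + 8 * w ^ 2 + w ^ 3 + 4 * w ^ 4) := by field_simp; ring
    _ ≤ (A * ((1 + r) ^ (n + 1))⁻¹) * (4 + A + 8 * A ^ 2 + A ^ 3 + 4 * A ^ 4) := by gcongr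
    _ = _ := by ring

end

section

open scoped SchwartzMap

lemma integrable_of_abs_le {n : ℕ} {h : Spc n → ℝ} (hm : AEStronglyMeasurable h) {C : ℝ}
    (hC : ∀ y, |h y| ≤ C * ((1 + ‖y‖) ^ (n + 1))⁻¹) : Integrable h :=
  (integrable_inv_one_add_norm_pow.const_mul C).mono' hm (.of_forall hC)

lemma integrable_mul_schwartz {n : ℕ} (f : 𝓢(Spc n, ℝ)) {h : Spc n → ℝ}
    (hm : AEStronglyMeasurable h) {C : ℝ} (hC : ∀ y, |h y| ≤ C * (1 + ‖y‖)) :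
    Integrable fun y => f y * h y := by
  obtain ⟨M, hM0, hM⟩ := (SchwartzBounded.singleton f).exists_abs_le (n + 2)
  refine integrable_of_abs_le (C := M * C) (f.continuous.aestronglyMeasurable.mul hm) fun y => ?_
  rw [abs_mul]
  calc |f y| * |h y| ≤ (M * ((1 + ‖y‖) ^ (n + 2))⁻¹) * (C * (1 + ‖y‖)) := by
        gcongr
        exacts [hM f rfl y, hC y]
    _ = M * C * ((1 + ‖y‖) ^ (n + 1))⁻¹ := by
        field_simp
        ring

lemma abs_apply_le_norm {n : ℕ} (y : Spc n) (i : Fin n) : |y i| ≤ ‖y‖ :=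
  PiLp.norm_apply_le y i

/-- The `i`-th term of the divergence of the flux field of a Schwartz function. -/
def fluxDiv (n : ℕ) (s β : ℝ) (f : 𝓢(Spc n, ℝ)) (i : Fin n) (y : Spc n) : ℝ :=
  dirDeriv (EuclideanSpace.single i 1) f y *
      (Ks n s (dirDeriv (EuclideanSpace.single i 1) f) y + β * y i) +
    f y * (Ks n s
      (dirDeriv (EuclideanSpace.single i 1) (dirDeriv (EuclideanSpace.single i 1) f)) y + β)

lemma fpField_apply {n : ℕ} (hn : 1 ≤ n) {s : ℝ} (hs : 0 < s) (hns : 2 * s < n) (β : ℝ)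
    (f : 𝓢(Spc n, ℝ)) (y : Spc n) (i : Fin n) :
    fpField n s β f y i =
      f y * (Ks n s (dirDeriv (EuclideanSpace.single i 1) f) y + β * y i) := by
  simp [fpField, gradient_Ks_apply hn hs hns, mul_add]

lemma differentiable_fpField_apply {n : ℕ} (hn : 1 ≤ n) {s : ℝ} (hs : 0 < s) (hns : 2 * s < n)
    (β : ℝ) (f : 𝓢(Spc n, ℝ)) (i : Fin n) :
    Differentiable ℝ fun y => fpField n s β f y i := by
  simp only [fpField_apply hn hs hns]
  have h := differentiable_Ks hn hs hns (dirDeriv (EuclideanSpace.single i 1) f)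
  have h2 := f.differentiable
  fun_prop

lemma fderiv_fpField_apply {n : ℕ} (hn : 1 ≤ n) {s : ℝ} (hs : 0 < s) (hns : 2 * s < n)
    (β : ℝ) (f : 𝓢(Spc n, ℝ)) (y : Spc n) (i : Fin n) :
    fderiv ℝ (fun z => fpField n s β f z i) y (EuclideanSpace.single i 1) =
      fluxDiv n s β f i y := by
  simp only [fpField_apply hn hs hns]
  have h := differentiable_Ks hn hs hns (dirDeriv (EuclideanSpace.single i 1) f)
  have hp : HasFDerivAt (fun z : Spc n => β * z i) (β • EuclideanSpace.proj i) y :=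
    (EuclideanSpace.proj (𝕜 := ℝ) i).hasFDerivAt.const_mul β
  have hd := (f.hasFDerivAt y).mul ((h y).hasFDerivAt.add hp)
  have hd' := hd.fderiv
  simp only [Pi.add_apply] at hd'
  rw [show (fun z => f z * (Ks n s (dirDeriv (EuclideanSpace.single i 1) f) z + β * z i)) =
    (⇑f * (Ks n s (dirDeriv (EuclideanSpace.single i 1) f) + fun z => β * z i) :
      Spc n → ℝ) from rfl, hd']
  simp only [fluxDiv, add_apply, smul_apply,
    fderiv_Ks hn hs hns, smul_eq_mul, SchwartzMap.lineDerivOp_apply_eq_fderiv]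
  simp
  ring

lemma continuous_fluxDiv {n : ℕ} (hn : 1 ≤ n) {s : ℝ} (hs : 0 < s) (hns : 2 * s < n)
    (β : ℝ) (f : 𝓢(Spc n, ℝ)) (i : Fin n) : Continuous (fluxDiv n s β f i) := by
  have h := fun g => (differentiable_Ks hn hs hns g).continuous
  unfold fluxDiv
  fun_prop

lemma SchwartzBounded.exists_abs_flux_le {n : ℕ} (hn : 1 ≤ n) {s : ℝ} (hs : 0 < s)
    (hns : 2 * s < n) (β : ℝ) {S : Set 𝓢(Spc n, ℝ)} (hS : SchwartzBounded S)
    (hpos : ∀ f ∈ S, ∀ y, 0 < f y) (i : Fin n) : ∃ C : ℝ, 0 ≤ C ∧ ∀ f ∈ S, ∀ y,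
      |fpField n s β f y i| ≤ C * ((1 + ‖y‖) * (√(f y) + f y)) ∧
      |fluxDiv n s β f i y| ≤ C * ((1 + ‖y‖) * (√(f y) + f y)) := by
  set e : Spc n := EuclideanSpace.single i 1 with he
  obtain ⟨C, hC0, hC⟩ := exists_abs_Ks_le hn hs hns
  obtain ⟨M, hM0, hM⟩ := ((hS.image_dirDeriv e).image_dirDeriv e).exists_abs_le 0
  obtain ⟨M₁, hM₁0, hM₁⟩ := (hS.image_dirDeriv e).exists_abs_le (n + 1)
  obtain ⟨M₂, hM₂0, hM₂⟩ := ((hS.image_dirDeriv e).image_dirDeriv e).exists_abs_le (n + 1)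
  set A := C * M₁ + |β| with hA
  set B := C * M₂ + |β| with hB
  have hA0 : 0 ≤ A := by positivity
  have hB0 : 0 ≤ B := by positivity
  refine ⟨√(4 * M) * A + B + A, by positivity, fun f hf y => ?_⟩
  have hu := hpos f hf y
  have h1 : |dirDeriv e f y| ≤ √(4 * M) * √(f y) := by
    rw [← Real.sqrt_mul (by positivity)]
    refine Real.abs_le_sqrt (lineDeriv_sq_le (fun x => (hpos f hf x).le) (fun x => ?_) y)
    simpa using hM _ (mem_image_of_mem _ (mem_image_of_mem _ hf)) x
  have h2 : |Ks n s (dirDeriv e f) y + β * y i| ≤ A * (1 + ‖y‖) := by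
    have h3 := (hC _ _ (hM₁ _ (mem_image_of_mem _ hf)) y).2
    have h4 : |β * y i| ≤ |β| * ‖y‖ := by
      rw [abs_mul]
      gcongr
      exact abs_apply_le_norm y i
    calc _ ≤ C * M₁ + |β| * ‖y‖ := (abs_add_le _ _).trans (add_le_add h3 h4)
      _ ≤ A * (1 + ‖y‖) := by
        have : 0 ≤ C * M₁ * ‖y‖ := by positivity
        rw [hA]
        linarith [abs_nonneg β]
  have h3 : |Ks n s (dirDeriv e (dirDeriv e f)) y + β| ≤ B :=
    (abs_add_le _ _).trans (add_le_add_left (hC _ _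
      (hM₂ _ (mem_image_of_mem _ (mem_image_of_mem _ hf))) y).2 _)
  have hr := norm_nonneg y
  have hsu := Real.sqrt_nonneg (f y)
  constructor
  · rw [fpField_apply hn hs hns, abs_mul, abs_of_pos hu]
    calc _ ≤ f y * (A * (1 + ‖y‖)) := by gcongr
      _ = A * ((1 + ‖y‖) * (0 + f y)) := by ring
      _ ≤ _ := by
        gcongr
        exact le_add_of_nonneg_left (by positivity)
  · rw [fluxDiv]
    refine (abs_add_le _ _).trans ?_
    rw [abs_mul, abs_mul, abs_of_pos hu]
    calc _ ≤ (√(4 * M) * √(f y)) * (A * (1 + ‖y‖)) + f y * B := by gcongr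
      _ = √(4 * M) * A * ((1 + ‖y‖) * (√(f y) + 0)) + B * ((1 + 0) * (0 + f y)) := by ring
      _ ≤ √(4 * M) * A * ((1 + ‖y‖) * (√(f y) + f y)) +
          B * ((1 + ‖y‖) * (√(f y) + f y)) := by gcongr
      _ = (√(4 * M) * A + B) * ((1 + ‖y‖) * (√(f y) + f y)) := by ring
      _ ≤ _ := mul_le_mul_of_nonneg_right (by linarith) (by positivity)

lemma SchwartzBounded.exists_mul_abs_log_le {n : ℕ} {S : Set 𝓢(Spc n, ℝ)}
    (hS : SchwartzBounded S) (hpos : ∀ f ∈ S, ∀ y, 0 < f y) : ∃ C : ℝ, 0 ≤ C ∧ ∀ f ∈ S, ∀ y,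
      (1 + ‖y‖) * (√(f y) + f y) * (|log (f y)| + 1) ≤ C * ((1 + ‖y‖) ^ (n + 1))⁻¹ := by
  obtain ⟨K, hK0, hK⟩ := hS.exists_abs_le (4 * (n + 2))
  obtain ⟨C, hC0, hC⟩ := _root_.exists_mul_abs_log_le n hK0
  exact ⟨C, hC0, fun f hf y => hC _ _ (norm_nonneg y) (hpos f hf y)
    ((le_abs_self _).trans (hK f hf y))⟩

lemma SchwartzBounded.exists_abs_flux_mul_log_le {n : ℕ} (hn : 1 ≤ n) {s : ℝ} (hs : 0 < s)
    (hns : 2 * s < n) (β : ℝ) {S : Set 𝓢(Spc n, ℝ)} (hS : SchwartzBounded S)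
    (hpos : ∀ f ∈ S, ∀ y, 0 < f y) (i : Fin n) : ∃ C : ℝ, 0 ≤ C ∧ ∀ f ∈ S, ∀ y,
      |fpField n s β f y i * (log (f y) + 1)| ≤ C * ((1 + ‖y‖) ^ (n + 1))⁻¹ ∧
      |fluxDiv n s β f i y * (log (f y) + 1)| ≤ C * ((1 + ‖y‖) ^ (n + 1))⁻¹ := by
  obtain ⟨C, hC0, hC⟩ := hS.exists_abs_flux_le hn hs hns β hpos i
  obtain ⟨K, hK0, hK⟩ := hS.exists_mul_abs_log_le hpos
  refine ⟨C * K, by positivity, fun f hf y => ?_⟩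
  have key : ∀ a : ℝ, |a| ≤ C * ((1 + ‖y‖) * (√(f y) + f y)) →
      |a * (log (f y) + 1)| ≤ C * K * ((1 + ‖y‖) ^ (n + 1))⁻¹ := by
    intro a ha
    have h1 : |log (f y) + 1| ≤ |log (f y)| + 1 := by simpa using abs_add_le (log (f y)) 1
    rw [abs_mul, mul_assoc C]
    calc _ ≤ C * ((1 + ‖y‖) * (√(f y) + f y)) * (|log (f y)| + 1) := by
          gcongr
          exact (abs_nonneg _).trans ha
      _ = C * ((1 + ‖y‖) * (√(f y) + f y) * (|log (f y)| + 1)) := by ring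
      _ ≤ _ := mul_le_mul_of_nonneg_left (hK f hf y) hC0
  exact ⟨key _ (hC f hf y).1, key _ (hC f hf y).2⟩

lemma integrable_mul_log {n : ℕ} (f : 𝓢(Spc n, ℝ)) (hpos : ∀ y, 0 < f y) :
    Integrable fun y => f y * log (f y) := by
  obtain ⟨K, hK0, hK⟩ := (SchwartzBounded.singleton f).exists_mul_abs_log_le
    (fun g hg => by rwa [mem_singleton_iff.1 hg])
  refine integrable_of_abs_le (C := K) ?_ fun y => (le_trans ?_ (hK f rfl y))
  · exact (f.continuous.mul (f.continuous.log fun y => (hpos y).ne')).aestronglyMeasurable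
  · have hu := hpos y
    rw [abs_mul, abs_of_pos hu]
    calc f y * |log (f y)| = (1 + 0) * (0 + f y) * (|log (f y)| + 0) := by ring
      _ ≤ _ := by gcongr <;> positivity

lemma integral_apply_mul_dirDeriv {n : ℕ} (f : 𝓢(Spc n, ℝ)) (i : Fin n) :
    ∫ y : Spc n, y i * dirDeriv (EuclideanSpace.single i 1) f y = -∫ y, f y := by
  have hp : ∀ y : Spc n, HasFDerivAt (fun z : Spc n => z i)
      (EuclideanSpace.proj i : Spc n →L[ℝ] ℝ) y :=
    fun y => (EuclideanSpace.proj (𝕜 := ℝ) i).hasFDerivAt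
  have hpc : Continuous fun z : Spc n => z i := by fun_prop
  have hb : ∀ y : Spc n, |y i| ≤ 1 * (1 + ‖y‖) := fun y => by
    linarith [abs_apply_le_norm y i]
  have h := integral_mul_fderiv_eq_neg_fderiv_mul_of_integrable (μ := (volume : Measure (Spc n)))
    (f := fun z : Spc n => z i) (g := f) (v := EuclideanSpace.single i 1)
    (by simpa [(hp _).fderiv] using f.integrable)
    ((integrable_mul_schwartz (dirDeriv (EuclideanSpace.single i 1) f) hpc.aestronglyMeasurable
      hb).congr (.of_forall fun y => mul_comm _ _))
    ((integrable_mul_schwartz f hpc.aestronglyMeasurable hb).congr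
      (.of_forall fun y => mul_comm _ _))
    (fun y _ => (hp y).differentiableAt) (fun y _ => f.differentiableAt)
  simpa [(hp _).fderiv] using! h

/-- One coordinate of the energy dissipation identity. -/
lemma integral_fluxDiv_mul_log {n : ℕ} (hn : 1 ≤ n) {s : ℝ} (hs : 0 < s) (hns : 2 * s < n)
    (β : ℝ) (f : 𝓢(Spc n, ℝ)) (hpos : ∀ y, 0 < f y) (i : Fin n) :
    Integrable (fun y => fluxDiv n s β f i y * (log (f y) + 1)) ∧
    Integrable (fun y => gradient (Hs n s f) y i ^ 2) ∧
    ∫ y, fluxDiv n s β f i y * (log (f y) + 1) =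
      -(∫ y, gradient (Hs n s f) y i ^ 2) + β * ∫ y, f y := by
  set e : Spc n := EuclideanSpace.single i 1 with he
  set g := dirDeriv e f with hg
  obtain ⟨C, -, hC⟩ := (SchwartzBounded.singleton f).exists_abs_flux_mul_log_le hn hs hns β
    (fun g hg => by rwa [mem_singleton_iff.1 hg]) i
  obtain ⟨M, -, hM⟩ := (SchwartzBounded.singleton g).exists_abs_le (n + 1)
  have hM := hM g rfl
  obtain ⟨K, hK0, hK⟩ := exists_abs_Ks_le hn hs hns
  have hK := fun y => (hK g M hM y).2
  have hKc := (differentiable_Ks hn hs hns g).continuous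
  have hL : ∀ y, HasFDerivAt (fun z => log (f z) + 1) ((f y)⁻¹ • fderiv ℝ f y) y :=
    fun y => ((f.hasFDerivAt y).log (hpos y).ne').add_const 1
  have hLc : Continuous fun y => log (f y) + 1 :=
    (f.continuous.log fun y => (hpos y).ne').add_const 1
  have hF := differentiable_fpField_apply hn hs hns β f i
  have hdiv : Integrable (fun y => fluxDiv n s β f i y * (log (f y) + 1)) :=
    integrable_of_abs_le ((continuous_fluxDiv hn hs hns β f i).mul hLc).aestronglyMeasurable
      fun y => (hC f rfl y).2
  have hflux : Integrable (fun y => fpField n s β f y i * (log (f y) + 1)) :=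
    integrable_of_abs_le (hF.continuous.mul hLc).aestronglyMeasurable fun y => (hC f rfl y).1
  have hgK : Integrable fun y => g y * Ks n s g y :=
    integrable_mul_schwartz g hKc.aestronglyMeasurable (C := K * M) fun y =>
      (hK y).trans (le_mul_of_one_le_right ((abs_nonneg _).trans (hK y))
        (by linarith [norm_nonneg y]))
  have hgy : Integrable fun y => g y * y i :=
    integrable_mul_schwartz g (by fun_prop : Continuous fun y : Spc n => y i).aestronglyMeasurable
      (C := 1) fun y => by linarith [abs_apply_le_norm y i]
  have heq : ∀ y, fpField n s β f y i * fderiv ℝ (fun z => log (f z) + 1) y e =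
      g y * Ks n s g y + β * (g y * y i) := by
    intro y
    have h1 : fderiv ℝ f y e = g y := rfl
    have := (hpos y).ne'
    rw [(hL y).fderiv, fpField_apply hn hs hns, smul_apply, h1, smul_eq_mul, ← he, ← hg]
    field_simp
  have hparts := integral_mul_fderiv_eq_neg_fderiv_mul_of_integrable
    (μ := (volume : Measure (Spc n))) (f := fun y => fpField n s β f y i)
    (g := fun y => log (f y) + 1) (v := e)
    (by simpa only [he, fderiv_fpField_apply hn hs hns] using hdiv)
    (by simpa only [heq] using! hgK.add (hgy.const_mul β))
    hflux (fun y _ => hF y) (fun y _ => (hL y).differentiableAt)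
  simp only [heq] at hparts
  simp only [he, fderiv_fpField_apply hn hs hns] at hparts
  rw [integral_add hgK (hgy.const_mul β), integral_const_mul] at hparts
  have hy : ∫ y, g y * y i = -∫ y, f y := by
    rw [← integral_apply_mul_dirDeriv f i]
    simp only [mul_comm, hg, he]
  have hns2 : 2 * (2 * (s / 2)) < n := by linarith
  have hsq := integral_Ks_sq hn (half_pos hs) hns2 g.continuous hM
  rw [show 2 * (s / 2) = s by ring] at hsq
  have hgrad : ∀ y, gradient (Hs n s f) y i = Ks n (s / 2) g y := fun y =>
    gradient_Ks_apply hn (half_pos hs) (by linarith) f y i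
  simp only [hgrad]
  refine ⟨hdiv, hsq.1, ?_⟩
  rw [hsq.2]
  rw [hy] at hparts
  linarith

/-- The energy dissipation identity at a fixed time. -/
lemma integral_sum_fluxDiv_mul_log {n : ℕ} (hn : 1 ≤ n) {s : ℝ} (hs : 0 < s) (hns : 2 * s < n)
    (β : ℝ) (f : 𝓢(Spc n, ℝ)) (hpos : ∀ y, 0 < f y) :
    ∫ y, (∑ i, fluxDiv n s β f i y) * (log (f y) + 1) =
      (-∫ y, ‖gradient (Hs n s f) y‖ ^ 2) + (n * β) * ∫ y, f y := by
  have h := integral_fluxDiv_mul_log hn hs hns β f hpos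
  simp only [Finset.sum_mul, EuclideanSpace.norm_sq_eq, Real.norm_eq_abs, sq_abs]
  rw [integral_finsetSum _ fun i _ => (h i).1, integral_finsetSum _ fun i _ => (h i).2.1,
    Finset.sum_congr rfl fun i _ => (h i).2.2]
  simp [Finset.sum_add_distrib, mul_assoc]

end

/-- First energy identity for the rescaled flow:
`d/dτ ∫ v log v dy = −∫ |∇H_s v|² dy + α ∫ v dy`. -/
theorem first_energy_identity
    (n : ℕ) (s : ℝ) (hn : 1 ≤ n) (hs0 : 0 < s) (hs1 : s < 1) (hns : 2 * s < (n : ℝ))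
    (β α : ℝ) (hβ : β = 1 / ((n : ℝ) + 2 - 2 * s)) (hα : α = (n : ℝ) / ((n : ℝ) + 2 - 2 * s))
    (v : ℝ → Spc n → ℝ)
    (hsmooth : ContDiffOn ℝ (⊤ : ℕ∞) (fun q : Spc n × ℝ => v q.2 q.1)
      (Set.univ ×ˢ Set.Ioi (0 : ℝ)))
    (hpos : ∀ τ : ℝ, 0 < τ → ∀ y : Spc n, 0 < v τ y)
    (hsol : SolvesFP n s β v)
    (hSch : SchwartzInTime n v) :
    ∀ τ : ℝ, 0 < τ →
      HasDerivAt (fun σ => ∫ y : Spc n, v σ y * Real.log (v σ y))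
        ((-∫ y : Spc n, ‖gradient (Hs n s (v τ)) y‖ ^ 2) + α * ∫ y : Spc n, v τ y) τ := by
  intro τ hτ
  obtain ⟨F, G, hF, -, hbd⟩ := hSch
  have hFv : ∀ σ, 0 < σ → v σ = F σ := fun σ hσ => funext fun y => (hF σ hσ y).symm
  have hFpos : ∀ σ, 0 < σ → ∀ y, 0 < F σ y := fun σ hσ y => by
    rw [hF σ hσ]
    exact hpos σ hσ y
  have hI : Icc (τ / 2) (2 * τ) ∈ nhds τ := Icc_mem_nhds (by linarith) (by linarith)
  have hI0 : ∀ σ ∈ Icc (τ / 2) (2 * τ), 0 < σ := fun σ hσ => (half_pos hτ).trans_le hσ.1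
  have hS : SchwartzBounded (F '' Icc (τ / 2) (2 * τ)) := by
    intro k l
    obtain ⟨M, hM⟩ := hbd k l (τ / 2) (2 * τ) (half_pos hτ)
    exact ⟨M, forall_mem_image.2 fun σ hσ => (hM σ hσ).1⟩
  have hSpos : ∀ f ∈ F '' Icc (τ / 2) (2 * τ), ∀ y, 0 < f y :=
    forall_mem_image.2 fun σ hσ => hFpos σ (hI0 σ hσ)
  choose C _ hC using hS.exists_abs_flux_mul_log_le hn hs0 hns β hSpos
  have hv : ∀ σ, 0 < σ → ∀ y,
      HasDerivAt (fun ρ => v ρ y) (∑ i, fluxDiv n s β (F σ) i y) σ := by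
    intro σ hσ y
    have hmem : (univ ×ˢ Ioi (0 : ℝ) : Set (Spc n × ℝ)) ∈ nhds (y, σ) :=
      (isOpen_univ.prod isOpen_Ioi).mem_nhds ⟨mem_univ y, hσ⟩
    have hd : DifferentiableAt ℝ (fun q : Spc n × ℝ => v q.2 q.1) (y, σ) :=
      (hsmooth.contDiffAt hmem).differentiableAt (by simp)
    have hd' : DifferentiableAt ℝ (fun ρ => v ρ y) σ :=
      hd.comp (f := fun ρ : ℝ => (y, ρ)) σ
        ((differentiableAt_const y).prodMk differentiableAt_id)
    have h := hd'.hasDerivAt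
    rw [hsol σ hσ y, hFv σ hσ] at h
    simpa only [fderiv_fpField_apply hn hs0 hns] using h
  have hcont : ∀ σ, 0 < σ → Continuous fun y => log (F σ y) := fun σ hσ =>
    (F σ).continuous.log fun y => (hFpos σ hσ y).ne'
  have key := (hasDerivAt_integral_of_dominated_loc_of_deriv_le (μ := (volume : Measure (Spc n)))
    (F := fun σ y => v σ y * log (v σ y))
    (F' := fun σ y => (∑ i, fluxDiv n s β (F σ) i y) * (log (F σ y) + 1))
    (bound := fun y => (∑ i, C i) * ((1 + ‖y‖) ^ (n + 1))⁻¹) hI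
    (by
      filter_upwards [hI] with σ hσ
      rw [hFv σ (hI0 σ hσ)]
      exact ((F σ).continuous.mul (hcont σ (hI0 σ hσ))).aestronglyMeasurable)
    (by
      rw [hFv τ hτ]
      exact integrable_mul_log (F τ) (hFpos τ hτ))
    ((continuous_finsetSum _ fun i _ => continuous_fluxDiv hn hs0 hns β (F τ) i).mul
      ((hcont τ hτ).add_const 1)).aestronglyMeasurable
    (.of_forall fun y σ hσ => by
      rw [Finset.sum_mul, Finset.sum_mul]
      exact norm_sum_le_of_le _ fun i _ => (hC i _ (mem_image_of_mem F hσ) y).2)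
    (integrable_inv_one_add_norm_pow.const_mul _)
    (.of_forall fun y σ hσ => by
      have h := hv σ (hI0 σ hσ) y
      have hne := (hpos σ (hI0 σ hσ) y).ne'
      refine (h.mul (h.log hne)).congr_deriv ?_
      rw [hF σ (hI0 σ hσ)]
      field_simp)).2
  refine key.congr_deriv ?_
  rw [integral_sum_fluxDiv_mul_log hn hs0 hns β (F τ) (hFpos τ hτ), hFv τ hτ, hα, hβ,
    mul_one_div]
end
end

section
/- Let v: ℝⁿ×(0,∞) → [0,∞) be a smooth solution of the rescaled equation v_τ = ∇_y·(v (∇_y K_s v + β y)) such that v(·,τ) and v_τ(·,τ) belong to the Schwartz class for every τ, with locally uniform bounds. Then for every τ > 0 the entropy dissipation identity holds: d/dτ E(v(τ)) = −I(v(τ)), where E(v) = (1/2) ∫_{ℝⁿ} (v K_s v + β|y|² v) dy and I(v) = ∫_{ℝⁿ} |∇(K_s v + (β/2)|y|²)|² v dy. -/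
open MeasureTheory Real Set Filter
open scoped RealInnerProductSpace

noncomputable section

/-- The entropy of the rescaled flow: `E(v) = (1/2)∫ (v K_s v + β|y|² v) dy`. -/
def entropyE (n : ℕ) (s β : ℝ) (v : Spc n → ℝ) : ℝ :=
  (1 / 2) * ∫ y : Spc n, (v y * Ks n s v y + β * ‖y‖ ^ 2 * v y)

/-- The entropy dissipation: `I(v) = ∫ |∇(K_s v + (β/2)|y|²)|² v dy`. -/
def entropyI (n : ℕ) (s β : ℝ) (v : Spc n → ℝ) : ℝ :=
  ∫ y : Spc n, ‖gradient (fun z : Spc n => Ks n s v z + (β / 2) * ‖z‖ ^ 2) y‖ ^ 2 * v y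

open scoped SchwartzMap ContDiff Topology

/-- The integrable weight `(1 + ‖x‖)^{-(n+1)}` on `ℝⁿ`. -/
def decayWeight (n : ℕ) (x : Spc n) : ℝ := ((1 + ‖x‖) ^ (n + 1))⁻¹

lemma decayWeight_nonneg (n : ℕ) (x : Spc n) : 0 ≤ decayWeight n x := by
  unfold decayWeight; positivity

lemma decayWeight_le_one (n : ℕ) (x : Spc n) : decayWeight n x ≤ 1 := by
  unfold decayWeight
  exact inv_le_one_of_one_le₀ (one_le_pow₀ (by linarith [norm_nonneg x]))

lemma continuous_decayWeight (n : ℕ) : Continuous (decayWeight n) := by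
  unfold decayWeight
  exact Continuous.inv₀ (by fun_prop) fun x => by positivity

lemma integrable_decayWeight (n : ℕ) : Integrable (decayWeight n) := by
  have h := integrable_one_add_norm (E := Spc n) (μ := volume) (r := (n : ℝ) + 1) (by simp)
  refine h.congr (.of_forall fun x => ?_)
  simp only [decayWeight]
  rw [rpow_neg (by positivity)]
  exact_mod_cast rfl

lemma decayWeight_le_of_dist_le_one {n : ℕ} {x y : Spc n} (h : ‖x - y‖ ≤ 1) :
    decayWeight n x ≤ 2 ^ (n + 1) * decayWeight n y := by
  unfold decayWeight
  have h1 : 1 + ‖y‖ ≤ 2 * (1 + ‖x‖) := by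
    have := norm_sub_norm_le y x
    rw [norm_sub_rev] at this
    linarith [norm_nonneg x]
  rw [← div_eq_mul_inv, inv_eq_one_div, div_le_div_iff₀ (by positivity) (by positivity), one_mul,
    ← mul_pow]
  exact pow_le_pow_left₀ (by positivity) h1 _

lemma integrable_norm_rpow_indicator {n : ℕ} (hn : 1 ≤ n) {p : ℝ} (hp : -(n : ℝ) < p) :
    Integrable (fun z : Spc n => (Iic (1 : ℝ)).indicator (fun r => r ^ p) ‖z‖) := by
  have : Nonempty (Fin n) := ⟨⟨0, hn⟩⟩
  rw [integrable_fun_norm_addHaar (E := Spc n) volume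
    (f := (Iic (1 : ℝ)).indicator (fun r => r ^ p))]
  have h1 : IntegrableOn (fun r : ℝ => r ^ ((n : ℝ) - 1 + p)) (Ioc 0 1) :=
    (intervalIntegrable_iff_integrableOn_Ioc_of_le zero_le_one).1
      (intervalIntegral.intervalIntegrable_rpow' (by linarith))
  have h2 : IntegrableOn ((Iic (1 : ℝ)).indicator fun r : ℝ => r ^ ((n : ℝ) - 1 + p)) (Ioi 0) := by
    rw [IntegrableOn, integrable_indicator_iff measurableSet_Iic, IntegrableOn,
      Measure.restrict_restrict measurableSet_Iic, Iic_inter_Ioi]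
    exact h1
  refine h2.congr_fun (fun r hr => ?_) measurableSet_Ioi
  by_cases h : r ∈ Iic (1 : ℝ)
  · simp only [indicator_of_mem h, smul_eq_mul, finrank_euclideanSpace, Fintype.card_fin]
    rw [rpow_add hr, ← rpow_natCast, Nat.cast_sub hn, Nat.cast_one]
  · simp [indicator_of_notMem h]

lemma exists_integral_norm_rpow_mul_decayWeight_le {n : ℕ} (hn : 1 ≤ n) {p : ℝ}
    (hp : -(n : ℝ) < p) (hp0 : p ≤ 0) :
    ∃ C : ℝ, 0 ≤ C ∧ ∀ x : Spc n, Integrable (fun z => ‖z‖ ^ p * decayWeight n (x - z)) ∧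
      ∫ z, ‖z‖ ^ p * decayWeight n (x - z) ≤ C := by
  have hI := integrable_norm_rpow_indicator hn hp
  have hW := integrable_decayWeight n
  have hI0 : ∀ z : Spc n, 0 ≤ (Iic (1 : ℝ)).indicator (fun r => r ^ p) ‖z‖ := fun z => by
    by_cases h : ‖z‖ ∈ Iic (1 : ℝ)
    · rw [indicator_of_mem h]; positivity
    · rw [indicator_of_notMem h]
  have hle : ∀ x z : Spc n, ‖z‖ ^ p * decayWeight n (x - z) ≤
      (Iic (1 : ℝ)).indicator (fun r => r ^ p) ‖z‖ + decayWeight n (x - z) := fun x z => by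
    have hw := decayWeight_nonneg n (x - z)
    by_cases h : ‖z‖ ∈ Iic (1 : ℝ)
    · rw [indicator_of_mem h]
      have := mul_le_of_le_one_right (rpow_nonneg (norm_nonneg z) p) (decayWeight_le_one n (x - z))
      linarith
    · rw [indicator_of_notMem h, zero_add]
      exact mul_le_of_le_one_left hw (rpow_le_one_of_one_le_of_nonpos (not_le.1 h).le hp0)
  have hsum : ∀ x : Spc n, Integrable fun z =>
      (Iic (1 : ℝ)).indicator (fun r => r ^ p) ‖z‖ + decayWeight n (x - z) :=
    fun x => hI.add (hW.comp_sub_left x)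
  refine ⟨(∫ z : Spc n, (Iic (1 : ℝ)).indicator (fun r => r ^ p) ‖z‖) + ∫ z, decayWeight n z,
    add_nonneg (integral_nonneg hI0) (integral_nonneg (decayWeight_nonneg n)), fun x => ?_⟩
  have hint : Integrable (fun z => ‖z‖ ^ p * decayWeight n (x - z)) := by
    refine (hsum x).mono' ?_ (.of_forall fun z => ?_)
    · exact (measurable_norm.pow_const p).aestronglyMeasurable.mul
        ((continuous_decayWeight n).comp (continuous_const.sub continuous_id)).aestronglyMeasurable
    · rw [norm_of_nonneg (mul_nonneg (by positivity) (decayWeight_nonneg n _))]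
      exact hle x z
  refine ⟨hint, (integral_mono hint (hsum x) (hle x)).trans_eq ?_⟩
  rw [integral_add hI (hW.comp_sub_left x), integral_sub_left_eq_self (decayWeight n) volume x]

/-- Convolution with the kernel `‖z‖^p`. -/
def rieszPotential {n : ℕ} {F : Type} [NormedAddCommGroup F] [NormedSpace ℝ F] (p : ℝ)
    (f : Spc n → F) (x : Spc n) : F :=
  ∫ z : Spc n, ‖z‖ ^ p • f (x - z)

section RieszPotential

variable {n : ℕ} {F : Type} [NormedAddCommGroup F] [NormedSpace ℝ F] {p : ℝ}

lemma aestronglyMeasurable_rieszPotential_integrand {f : Spc n → F} (hf : Continuous f)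
    (x : Spc n) : AEStronglyMeasurable (fun z : Spc n => ‖z‖ ^ p • f (x - z)) :=
  (measurable_norm.pow_const p).aestronglyMeasurable.smul
    (hf.comp (continuous_const.sub continuous_id)).aestronglyMeasurable

lemma norm_rieszPotential_integrand_le {f : Spc n → F} {C : ℝ}
    (hC : ∀ x, ‖f x‖ ≤ C * decayWeight n x) (x z : Spc n) :
    ‖‖z‖ ^ p • f (x - z)‖ ≤ C * (‖z‖ ^ p * decayWeight n (x - z)) := by
  have h0 : 0 ≤ ‖z‖ ^ p := by positivity
  rw [norm_smul, norm_of_nonneg h0, mul_left_comm]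
  exact mul_le_mul_of_nonneg_left (hC _) h0

lemma integrable_rieszPotential_integrand (hn : 1 ≤ n) (hp : -(n : ℝ) < p) (hp0 : p ≤ 0)
    {f : Spc n → F} (hf : Continuous f) {C : ℝ} (hC : ∀ x, ‖f x‖ ≤ C * decayWeight n x)
    (x : Spc n) : Integrable (fun z : Spc n => ‖z‖ ^ p • f (x - z)) := by
  obtain ⟨_, _, h⟩ := exists_integral_norm_rpow_mul_decayWeight_le hn hp hp0
  exact ((h x).1.const_mul C).mono' (aestronglyMeasurable_rieszPotential_integrand hf x)
    (.of_forall (norm_rieszPotential_integrand_le hC x))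

lemma exists_norm_rieszPotential_le (hn : 1 ≤ n) (hp : -(n : ℝ) < p) (hp0 : p ≤ 0) :
    ∃ C₀ : ℝ, 0 ≤ C₀ ∧ ∀ (F : Type) [NormedAddCommGroup F] [NormedSpace ℝ F]
      (f : Spc n → F) (C : ℝ), 0 ≤ C → (∀ x, ‖f x‖ ≤ C * decayWeight n x) →
      ∀ x, ‖rieszPotential p f x‖ ≤ C * C₀ := by
  obtain ⟨C₀, h0, h⟩ := exists_integral_norm_rpow_mul_decayWeight_le hn hp hp0
  refine ⟨C₀, h0, fun F _ _ f C hC0 hC x => ?_⟩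
  refine (norm_integral_le_of_norm_le ((h x).1.const_mul C)
    (.of_forall (norm_rieszPotential_integrand_le hC x))).trans ?_
  rw [integral_const_mul]
  exact mul_le_mul_of_nonneg_left (h x).2 hC0

end RieszPotential

namespace SchwartzMap

variable {n : ℕ} {F : Type} [NormedAddCommGroup F] [NormedSpace ℝ F]

lemma one_add_norm_pow_mul_norm_le (f : 𝓢(Spc n, F)) (k : ℕ) (x : Spc n) :
    (1 + ‖x‖) ^ k * ‖f x‖ ≤
      2 ^ (k - 1) * (SchwartzMap.seminorm ℝ 0 0 f + SchwartzMap.seminorm ℝ k 0 f) := by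
  have h1 := SchwartzMap.norm_pow_mul_le_seminorm ℝ f k x
  have h2 := SchwartzMap.norm_le_seminorm ℝ f x
  have h3 := add_pow_le zero_le_one (norm_nonneg x) k
  rw [one_pow] at h3
  calc (1 + ‖x‖) ^ k * ‖f x‖ ≤ 2 ^ (k - 1) * (1 + ‖x‖ ^ k) * ‖f x‖ := by gcongr
    _ = 2 ^ (k - 1) * (‖f x‖ + ‖x‖ ^ k * ‖f x‖) := by ring
    _ ≤ _ := by gcongr

lemma exists_norm_le_decayWeight (f : 𝓢(Spc n, F)) :
    ∃ C : ℝ, 0 ≤ C ∧ ∀ x, ‖f x‖ ≤ C * decayWeight n x := by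
  refine ⟨2 ^ (n + 1 - 1) * (SchwartzMap.seminorm ℝ 0 0 f + SchwartzMap.seminorm ℝ (n + 1) 0 f),
    by positivity, fun x => ?_⟩
  rw [decayWeight, ← div_eq_mul_inv, le_div_iff₀ (by positivity), mul_comm]
  exact f.one_add_norm_pow_mul_norm_le (n + 1) x

variable {p : ℝ}

lemma hasFDerivAt_rieszPotential (hn : 1 ≤ n) (hp : -(n : ℝ) < p) (hp0 : p ≤ 0)
    (f : 𝓢(Spc n, F)) (x : Spc n) :
    HasFDerivAt (rieszPotential p f)
      (rieszPotential p (fderivCLM ℝ (Spc n) F f) x) x := by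
  obtain ⟨C, -, hC⟩ := f.exists_norm_le_decayWeight
  obtain ⟨C', hC'0, hC'⟩ := (fderivCLM ℝ (Spc n) F f).exists_norm_le_decayWeight
  obtain ⟨_, _, hW⟩ := exists_integral_norm_rpow_mul_decayWeight_le hn hp hp0
  refine hasFDerivAt_integral_of_dominated_of_fderiv_le
    (F := fun x z => ‖z‖ ^ p • f (x - z))
    (F' := fun x z => ‖z‖ ^ p • fderivCLM ℝ (Spc n) F f (x - z))
    (bound := fun z => C' * (‖z‖ ^ p * (2 ^ (n + 1) * decayWeight n (x - z))))
    (Metric.ball_mem_nhds x one_pos)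
    (.of_forall fun y => aestronglyMeasurable_rieszPotential_integrand f.continuous y)
    (integrable_rieszPotential_integrand hn hp hp0 f.continuous hC x)
    (aestronglyMeasurable_rieszPotential_integrand (SchwartzMap.continuous _) x)
    (.of_forall fun z y hy => ?_) ?_ (.of_forall fun z y _ => ?_)
  · refine (norm_rieszPotential_integrand_le hC' y z).trans ?_
    have : decayWeight n (y - z) ≤ 2 ^ (n + 1) * decayWeight n (x - z) :=
      decayWeight_le_of_dist_le_one (by
        rw [sub_sub_sub_cancel_right, ← dist_eq_norm]; exact (Metric.mem_ball.1 hy).le)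
    gcongr
  · refine ((hW x).1.const_mul (C' * 2 ^ (n + 1))).congr (.of_forall fun z => ?_)
    ring
  · have h := (f.hasFDerivAt (x := y - z)).comp y ((hasFDerivAt_id y).sub_const z)
    rw [ContinuousLinearMap.comp_id] at h
    exact h.const_smul (‖z‖ ^ p)

lemma contDiff_rieszPotential (hn : 1 ≤ n) (hp : -(n : ℝ) < p) (hp0 : p ≤ 0) (m : ℕ) :
    ∀ {F : Type} [NormedAddCommGroup F] [NormedSpace ℝ F] (f : 𝓢(Spc n, F)),
      ContDiff ℝ m (rieszPotential p f) ∧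
        ∃ C, ∀ x, ‖iteratedFDeriv ℝ m (rieszPotential p f) x‖ ≤ C := by
  induction m with
  | zero =>
    intro F _ _ f
    obtain ⟨C, hC0, hC⟩ := f.exists_norm_le_decayWeight
    obtain ⟨C₀, -, h⟩ := exists_norm_rieszPotential_le (n := n) hn hp hp0
    refine ⟨contDiff_zero.2 <| continuous_iff_continuousAt.2 fun x =>
      (f.hasFDerivAt_rieszPotential hn hp hp0 x).continuousAt, C * C₀, fun x => ?_⟩
    rw [norm_iteratedFDeriv_zero]
    exact h F f C hC0 hC x
  | succ m ih =>
    intro F _ _ f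
    have hd : fderiv ℝ (rieszPotential p f) = rieszPotential p (fderivCLM ℝ (Spc n) F f) :=
      funext fun x => (f.hasFDerivAt_rieszPotential hn hp hp0 x).fderiv
    obtain ⟨h1, C, hC⟩ := ih (fderivCLM ℝ (Spc n) F f)
    refine ⟨?_, C, fun x => ?_⟩
    · rw [Nat.cast_add, Nat.cast_one, contDiff_succ_iff_fderiv]
      refine ⟨fun x => (f.hasFDerivAt_rieszPotential hn hp hp0 x).differentiableAt, by simp, ?_⟩
      rwa [hd]
    · rw [← norm_iteratedFDeriv_fderiv, hd]
      exact hC x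

lemma hasTemperateGrowth_rieszPotential (hn : 1 ≤ n) (hp : -(n : ℝ) < p) (hp0 : p ≤ 0)
    (f : 𝓢(Spc n, F)) : (rieszPotential p f).HasTemperateGrowth := by
  refine ⟨contDiff_infty.2 fun m => (contDiff_rieszPotential hn hp hp0 m f).1, fun m => ?_⟩
  obtain ⟨C, hC⟩ := (contDiff_rieszPotential hn hp hp0 m f).2
  exact ⟨0, C, fun x => by simpa using hC x⟩

end SchwartzMap

lemma rieszPotential_eq_integral {n : ℕ} {F : Type} [NormedAddCommGroup F] [NormedSpace ℝ F]
    (p : ℝ) (f : Spc n → F) (x : Spc n) :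
    rieszPotential p f x = ∫ y, ‖x - y‖ ^ p • f y := by
  rw [rieszPotential, ← integral_sub_left_eq_self _ volume x]
  simp

lemma Ks_eq_rieszConst_mul_rieszPotential (n : ℕ) (s : ℝ) (u : Spc n → ℝ) (x : Spc n) :
    Ks n s u x = rieszConst n s * rieszPotential (2 * s - n) u x := by
  rw [Ks, rieszPotential_eq_integral]
  rfl

/-- The convolution operator with kernel `‖z‖^p` is symmetric. -/
lemma integral_mul_rieszPotential_comm {n : ℕ} (hn : 1 ≤ n) {p : ℝ} (hp : -(n : ℝ) < p)
    (hp0 : p ≤ 0) (f g : 𝓢(Spc n, ℝ)) :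
    ∫ x, f x * rieszPotential p g x = ∫ x, g x * rieszPotential p f x := by
  obtain ⟨C, hC0, hC⟩ := g.exists_norm_le_decayWeight
  obtain ⟨C₀, -, h⟩ := exists_norm_rieszPotential_le (n := n) hn hp hp0
  have hmeas : AEStronglyMeasurable
      (Function.uncurry fun x y : Spc n => f x * (‖x - y‖ ^ p * g y)) (volume.prod volume) := by
    refine Measurable.aestronglyMeasurable ?_
    have hf := f.continuous.measurable
    have hg := g.continuous.measurable
    simp only [Function.uncurry_def]
    fun_prop
  have hint : Integrable (Function.uncurry fun x y : Spc n => f x * (‖x - y‖ ^ p * g y))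
      (volume.prod volume) := by
    refine (integrable_prod_iff hmeas).2 ⟨.of_forall fun x => ?_, ?_⟩
    · have := (integrable_rieszPotential_integrand hn hp hp0 g.continuous hC x).comp_sub_left x
      simp only [sub_sub_cancel, smul_eq_mul] at this
      exact this.const_mul (f x)
    · refine ((f.integrable (μ := volume)).norm.mul_const (C * C₀)).mono'
        hmeas.norm.integral_prod_right' (.of_forall fun x => ?_)
      have hx : ∫ y, ‖Function.uncurry (fun x y : Spc n => f x * (‖x - y‖ ^ p * g y)) (x, y)‖ =
          ‖f x‖ * rieszPotential p (fun y => ‖g y‖) x := by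
        rw [rieszPotential_eq_integral, ← integral_const_mul]
        refine integral_congr_ae (.of_forall fun y => ?_)
        simp only [Function.uncurry_apply_pair, norm_mul, smul_eq_mul]
        rw [norm_of_nonneg (rpow_nonneg (norm_nonneg _) _)]
      rw [hx, norm_mul, norm_norm]
      gcongr
      exact h ℝ (fun y => ‖g y‖) C hC0 (by simpa using hC) x
  calc ∫ x, f x * rieszPotential p g x = ∫ x, ∫ y, f x * (‖x - y‖ ^ p * g y) := by
        simp_rw [rieszPotential_eq_integral, ← integral_const_mul, smul_eq_mul]
    _ = ∫ y, ∫ x, f x * (‖x - y‖ ^ p * g y) := integral_integral_swap hint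
    _ = ∫ y, g y * rieszPotential p f y := by
        simp_rw [rieszPotential_eq_integral, ← integral_const_mul, smul_eq_mul]
        refine integral_congr_ae (.of_forall fun y => integral_congr_ae (.of_forall fun x => ?_))
        simp only [norm_sub_rev x y]
        ring

lemma hasDerivAt_rieszPotential_of_decay {n : ℕ} (hn : 1 ≤ n) {p : ℝ} (hp : -(n : ℝ) < p)
    (hp0 : p ≤ 0) {f g : ℝ → 𝓢(Spc n, ℝ)} {S : Set ℝ} {C : ℝ} {τ : ℝ} (hS : S ∈ 𝓝 τ)
    (hf : ∀ x, ‖f τ x‖ ≤ C * decayWeight n x)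
    (hg : ∀ σ ∈ S, ∀ x, ‖g σ x‖ ≤ C * decayWeight n x)
    (hfg : ∀ σ ∈ S, ∀ x, HasDerivAt (fun σ => f σ x) (g σ x) σ) (x : Spc n) :
    HasDerivAt (fun σ => rieszPotential p (f σ) x) (rieszPotential p (g τ) x) τ := by
  obtain ⟨_, _, hW⟩ := exists_integral_norm_rpow_mul_decayWeight_le hn hp hp0
  exact (hasDerivAt_integral_of_dominated_loc_of_deriv_le
    (F := fun σ z => ‖z‖ ^ p • f σ (x - z)) (F' := fun σ z => ‖z‖ ^ p • g σ (x - z))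
    (bound := fun z => C * (‖z‖ ^ p * decayWeight n (x - z))) hS
    (.of_forall fun σ => aestronglyMeasurable_rieszPotential_integrand (f σ).continuous x)
    (integrable_rieszPotential_integrand hn hp hp0 (f τ).continuous hf x)
    (aestronglyMeasurable_rieszPotential_integrand (g τ).continuous x)
    (.of_forall fun z σ hσ => norm_rieszPotential_integrand_le (hg σ hσ) x z)
    ((hW x).1.const_mul C)
    (.of_forall fun z σ hσ => (hfg σ hσ (x - z)).const_smul (‖z‖ ^ p))).2

lemma SchwartzMap.hasTemperateGrowth_Ks {n : ℕ} {s : ℝ} (hn : 1 ≤ n) (hs : 0 < s)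
    (hns : 2 * s < n) (f : 𝓢(Spc n, ℝ)) : (Ks n s f).HasTemperateGrowth := by
  have h := f.hasTemperateGrowth_rieszPotential (p := 2 * s - n) hn (by linarith) (by linarith)
  rw [funext (Ks_eq_rieszConst_mul_rieszPotential n s f)]
  fun_prop

/-- A Schwartz function times a function of temperate growth is integrable. -/
lemma SchwartzMap.integrable_mul_of_hasTemperateGrowth {n : ℕ} (f : 𝓢(Spc n, ℝ))
    {φ : Spc n → ℝ} (hφ : φ.HasTemperateGrowth) : Integrable (fun x => f x * φ x) := by
  refine (smulLeftCLM ℝ φ f).integrable.congr (.of_forall fun x => ?_)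
  simp only [smulLeftCLM_apply_apply hφ, smul_eq_mul, mul_comm]

/-- Time derivative of the entropy along a curve of Schwartz functions with locally uniform
decay. -/
lemma hasDerivAt_entropyE {n : ℕ} {s : ℝ} (hn : 1 ≤ n) (hs : 0 < s) (hns : 2 * s < n) (β : ℝ)
    {f g : ℝ → 𝓢(Spc n, ℝ)} {S : Set ℝ} {C : ℝ} {τ : ℝ} (hS : IsOpen S) (hτ : τ ∈ S)
    (hC0 : 0 ≤ C)
    (hf : ∀ σ ∈ S, ∀ x, (1 + ‖x‖) ^ 2 * ‖f σ x‖ ≤ C * decayWeight n x)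
    (hg : ∀ σ ∈ S, ∀ x, (1 + ‖x‖) ^ 2 * ‖g σ x‖ ≤ C * decayWeight n x)
    (hfg : ∀ σ ∈ S, ∀ x, HasDerivAt (fun σ => f σ x) (g σ x) σ) :
    HasDerivAt (fun σ => entropyE n s β (f σ))
      (∫ x, g τ x * (Ks n s (f τ) x + β / 2 * ‖x‖ ^ 2)) τ := by
  have hp : -(n : ℝ) < 2 * s - n := by linarith
  have hp0 : 2 * s - n ≤ 0 := by linarith
  obtain ⟨C₀, hC₀, hbd⟩ := exists_norm_rieszPotential_le (n := n) hn hp hp0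
  have hone (x : Spc n) : 1 ≤ (1 + ‖x‖) ^ 2 := one_le_pow₀ (by linarith [norm_nonneg x])
  have hf' : ∀ σ ∈ S, ∀ x, ‖f σ x‖ ≤ C * decayWeight n x := fun σ hσ x =>
    (le_mul_of_one_le_left (norm_nonneg _) (hone x)).trans (hf σ hσ x)
  have hg' : ∀ σ ∈ S, ∀ x, ‖g σ x‖ ≤ C * decayWeight n x := fun σ hσ x =>
    (le_mul_of_one_le_left (norm_nonneg _) (hone x)).trans (hg σ hσ x)
  have hKbd : ∀ (u : Spc n → ℝ), (∀ x, ‖u x‖ ≤ C * decayWeight n x) →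
      ∀ x, ‖Ks n s u x‖ ≤ ‖rieszConst n s‖ * (C * C₀) := fun u hu x => by
    rw [Ks_eq_rieszConst_mul_rieszPotential, norm_mul]
    gcongr
    exact hbd ℝ u C hC0 hu x
  have hKd : ∀ σ ∈ S, ∀ x, HasDerivAt (fun σ => Ks n s (f σ) x) (Ks n s (g σ) x) σ :=
    fun σ hσ x => by
      simp_rw [Ks_eq_rieszConst_mul_rieszPotential]
      exact (hasDerivAt_rieszPotential_of_decay hn hp hp0 (hS.mem_nhds hσ) (hf' σ hσ) hg' hfg
        x).const_mul _
  have hsq : Function.HasTemperateGrowth fun x : Spc n => ‖x‖ ^ 2 :=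
    Function.hasTemperateGrowth_norm_sq (Spc n)
  have hKf := fun σ => (f σ).hasTemperateGrowth_Ks hn hs hns
  have hKg := fun σ => (g σ).hasTemperateGrowth_Ks hn hs hns
  have hint₁ := (f τ).integrable_mul_of_hasTemperateGrowth
    ((hKf τ).fun_add ((Function.HasTemperateGrowth.const β).mul hsq))
  have hder := (hasDerivAt_integral_of_dominated_loc_of_deriv_le (μ := volume)
    (F := fun σ x => f σ x * Ks n s (f σ) x + β * ‖x‖ ^ 2 * f σ x)
    (F' := fun σ x => g σ x * Ks n s (f σ) x + f σ x * Ks n s (g σ) x + β * ‖x‖ ^ 2 * g σ x)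
    (bound := fun x => (2 * (C * (‖rieszConst n s‖ * (C * C₀))) + ‖β‖ * C) * decayWeight n x)
    (hS.mem_nhds hτ) (.of_forall fun σ => ?_) (hint₁.congr (.of_forall fun x => by simp; ring))
    ?_ (.of_forall fun x σ hσ => ?_) ((integrable_decayWeight n).const_mul _)
    (.of_forall fun x σ hσ => ?_)).2.const_mul (1 / 2)
  · refine hder.congr_deriv ?_
    have i₁ : Integrable fun x => g τ x * Ks n s (f τ) x :=
      (g τ).integrable_mul_of_hasTemperateGrowth (hKf τ)
    have i₂ : Integrable fun x => f τ x * Ks n s (g τ) x :=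
      (f τ).integrable_mul_of_hasTemperateGrowth (hKg τ)
    have i₃ : Integrable fun x => g τ x * ‖x‖ ^ 2 :=
      (g τ).integrable_mul_of_hasTemperateGrowth hsq
    have i₁₂ : Integrable fun x => g τ x * Ks n s (f τ) x + f τ x * Ks n s (g τ) x := i₁.add i₂
    have hsymm : ∫ x, f τ x * Ks n s (g τ) x = ∫ x, g τ x * Ks n s (f τ) x := by
      simp_rw [Ks_eq_rieszConst_mul_rieszPotential, mul_left_comm _ (rieszConst n s),
        integral_const_mul, integral_mul_rieszPotential_comm hn hp hp0 (f τ) (g τ)]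
    have e₁ : ∀ x, β * ‖x‖ ^ 2 * g τ x = β * (g τ x * ‖x‖ ^ 2) := fun x => by ring
    have e₂ : ∀ x, g τ x * (Ks n s (f τ) x + β / 2 * ‖x‖ ^ 2) =
        g τ x * Ks n s (f τ) x + β / 2 * (g τ x * ‖x‖ ^ 2) := fun x => by ring
    simp_rw [e₁, e₂]
    rw [integral_add i₁₂ (i₃.const_mul _), integral_add i₁ i₂,
      integral_add i₁ (i₃.const_mul _), hsymm, integral_const_mul, integral_const_mul]
    ring
  · have := (f σ).continuous
    have := (hKf σ).1.continuous
    exact Continuous.aestronglyMeasurable (by fun_prop)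
  · have := (f τ).continuous
    have := (hKf τ).1.continuous
    have := (g τ).continuous
    have := (hKg τ).1.continuous
    exact Continuous.aestronglyMeasurable (by fun_prop)
  · have hw := decayWeight_nonneg n x
    have h₁ : ‖g σ x * Ks n s (f σ) x‖ ≤ C * decayWeight n x * (‖rieszConst n s‖ * (C * C₀)) := by
      rw [norm_mul]
      exact mul_le_mul (hg' σ hσ x) (hKbd _ (hf' σ hσ) x) (norm_nonneg _) (by positivity)
    have h₂ : ‖f σ x * Ks n s (g σ) x‖ ≤ C * decayWeight n x * (‖rieszConst n s‖ * (C * C₀)) := by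
      rw [norm_mul]
      exact mul_le_mul (hf' σ hσ x) (hKbd _ (hg' σ hσ) x) (norm_nonneg _) (by positivity)
    have h₃ : ‖β * ‖x‖ ^ 2 * g σ x‖ ≤ ‖β‖ * (C * decayWeight n x) := by
      rw [norm_mul, norm_mul, mul_assoc, norm_pow, norm_norm]
      refine mul_le_mul_of_nonneg_left (le_trans ?_ (hg σ hσ x)) (norm_nonneg _)
      gcongr
      linarith
    refine (norm_add₃_le.trans (add_le_add (add_le_add h₁ h₂) h₃)).trans_eq ?_
    ring
  · have h := ((hfg σ hσ x).mul (hKd σ hσ x)).add ((hfg σ hσ x).const_mul (β * ‖x‖ ^ 2))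
    exact h

lemma Function.HasTemperateGrowth.fderiv_apply {n : ℕ} {φ : Spc n → ℝ}
    (hφ : φ.HasTemperateGrowth) (e : Spc n) :
    Function.HasTemperateGrowth fun x => fderiv ℝ φ x e := by
  have h : (fderiv ℝ φ).HasTemperateGrowth := by
    refine ⟨hφ.1.fderiv_right (by simp), fun m => ?_⟩
    obtain ⟨k, C, h⟩ := hφ.2 (m + 1)
    exact ⟨k, C, fun x => by rw [norm_iteratedFDeriv_fderiv]; exact h x⟩
  exact (ContinuousLinearMap.apply ℝ ℝ).bilinear_hasTemperateGrowth (.const e) h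

lemma gradient_apply_eq_fderiv {n : ℕ} (φ : Spc n → ℝ) (x : Spc n) (i : Fin n) :
    gradient φ x i = fderiv ℝ φ x (EuclideanSpace.single i 1) := by
  rw [← inner_gradient_left, EuclideanSpace.inner_single_right]
  simp

/-- Integration by parts: `∫ ∇·(f ∇φ) φ = -∫ |∇φ|² f`. -/
lemma SchwartzMap.integral_divergence_mul_eq_neg {n : ℕ} (f : 𝓢(Spc n, ℝ)) {φ : Spc n → ℝ}
    (hφ : φ.HasTemperateGrowth) :
    ∫ x, (∑ i : Fin n, fderiv ℝ (fun z => f z * gradient φ z i) x (EuclideanSpace.single i 1)) *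
      φ x = -∫ x, ‖gradient φ x‖ ^ 2 * f x := by
  have hφi := fun i : Fin n => hφ.fderiv_apply (EuclideanSpace.single i 1)
  let W : Fin n → 𝓢(Spc n, ℝ) := fun i =>
    smulLeftCLM ℝ (fun x => fderiv ℝ φ x (EuclideanSpace.single i 1)) f
  have hW : ∀ i, (fun z => f z * gradient φ z i) = W i := fun i => funext fun z => by
    simp only [W, smulLeftCLM_apply_apply (hφi i), gradient_apply_eq_fderiv, smul_eq_mul, mul_comm]
  have hint₁ : ∀ i, Integrable fun x => φ x * fderiv ℝ (W i) x (EuclideanSpace.single i 1) :=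
    fun i => ((LineDeriv.lineDerivOp (EuclideanSpace.single i (1 : ℝ))
      (W i)).integrable_mul_of_hasTemperateGrowth hφ).congr
        (.of_forall fun x => by simp only [lineDerivOp_apply_eq_fderiv, mul_comm])
  have hint₂ : ∀ i, Integrable fun x => fderiv ℝ φ x (EuclideanSpace.single i 1) * W i x :=
    fun i => ((W i).integrable_mul_of_hasTemperateGrowth (hφi i)).congr
      (.of_forall fun x => mul_comm _ _)
  have hint₃ : ∀ i, Integrable fun x => φ x * W i x :=
    fun i => ((W i).integrable_mul_of_hasTemperateGrowth hφ).congr (.of_forall fun x => mul_comm _ _)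
  calc _ = ∑ i, ∫ x, φ x * fderiv ℝ (W i) x (EuclideanSpace.single i 1) := by
        rw [← integral_finsetSum _ fun i _ => hint₁ i]
        simp_rw [hW, Finset.sum_mul, mul_comm (φ _)]
    _ = ∑ i, -∫ x, fderiv ℝ φ x (EuclideanSpace.single i 1) * W i x :=
        Finset.sum_congr rfl fun i _ => integral_mul_fderiv_eq_neg_fderiv_mul_of_integrable
          (hint₂ i) (hint₁ i) (hint₃ i) (fun x _ => hφ.1.differentiable (by simp) x)
          (fun x _ => (W i).differentiableAt)
    _ = _ := by
        rw [Finset.sum_neg_distrib, ← integral_finsetSum _ fun i _ => hint₂ i]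
        simp_rw [← hW, ← gradient_apply_eq_fderiv, EuclideanSpace.real_norm_sq_eq, Finset.sum_mul]
        congr 2 with x
        exact Finset.sum_congr rfl fun i _ => by ring

lemma SchwartzMap.gradient_Ks_add_norm_sq {n : ℕ} {s : ℝ} (hn : 1 ≤ n) (hs : 0 < s)
    (hns : 2 * s < n) (β : ℝ) (f : 𝓢(Spc n, ℝ)) (x : Spc n) :
    gradient (fun z => Ks n s f z + β / 2 * ‖z‖ ^ 2) x = gradient (Ks n s f) x + β • x := by
  have h₁ : HasGradientAt (Ks n s f) (gradient (Ks n s f) x) x :=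
    ((f.hasTemperateGrowth_Ks hn hs hns).1.differentiable (by simp) x).hasGradientAt
  refine HasGradientAt.gradient ?_
  have h₂ := h₁.hasFDerivAt.add ((hasStrictFDerivAt_norm_sq x).hasFDerivAt.const_mul (β / 2))
  rw [hasGradientAt_iff_hasFDerivAt]
  refine h₂.congr_fderiv ?_
  ext y
  simp
  ring

/-- Entropy–entropy dissipation identity for the rescaled flow:
`d/dτ E(v(τ)) = −I(v(τ))`. -/
theorem entropy_dissipation_identity
    (n : ℕ) (s : ℝ) (hn : 1 ≤ n) (hs0 : 0 < s) (hs1 : s < 1) (hns : 2 * s < (n : ℝ))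
    (β α : ℝ) (hβ : β = 1 / ((n : ℝ) + 2 - 2 * s)) (hα : α = (n : ℝ) / ((n : ℝ) + 2 - 2 * s))
    (v : ℝ → Spc n → ℝ)
    (hsmooth : ContDiffOn ℝ (⊤ : ℕ∞) (fun q : Spc n × ℝ => v q.2 q.1)
      (Set.univ ×ˢ Set.Ioi (0 : ℝ)))
    (hpos : ∀ τ : ℝ, 0 < τ → ∀ y : Spc n, 0 ≤ v τ y)
    (hsol : SolvesFP n s β v)
    (hSch : SchwartzInTime n v) :
    ∀ τ : ℝ, 0 < τ →
      HasDerivAt (fun σ => entropyE n s β (v σ)) (-(entropyI n s β (v τ))) τ := by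
  intro τ hτ
  obtain ⟨F, G, hF, hG, hM⟩ := hSch
  obtain ⟨M₀, hM₀⟩ := hM 0 0 (τ / 2) (2 * τ) (by linarith)
  obtain ⟨M₁, hM₁⟩ := hM (n + 3) 0 (τ / 2) (2 * τ) (by linarith)
  have hmem : τ ∈ Ioo (τ / 2) (2 * τ) := ⟨by linarith, by linarith⟩
  have hpos' : ∀ σ ∈ Ioo (τ / 2) (2 * τ), 0 < σ := fun σ hσ => by linarith [hσ.1]
  have hdecay : ∀ f : 𝓢(Spc n, ℝ), SchwartzMap.seminorm ℝ 0 0 f ≤ M₀ →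
      SchwartzMap.seminorm ℝ (n + 3) 0 f ≤ M₁ → ∀ x,
      (1 + ‖x‖) ^ 2 * ‖f x‖ ≤ 2 ^ (n + 2) * (M₀ + M₁) * decayWeight n x := fun f h₀ h₁ x => by
    rw [decayWeight, ← div_eq_mul_inv, le_div_iff₀ (by positivity)]
    calc (1 + ‖x‖) ^ 2 * ‖f x‖ * (1 + ‖x‖) ^ (n + 1) = (1 + ‖x‖) ^ (n + 3) * ‖f x‖ := by ring
      _ ≤ _ := f.one_add_norm_pow_mul_norm_le (n + 3) x
      _ ≤ _ := by rw [Nat.add_sub_assoc (by norm_num)]; gcongr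
  have hM₀' : 0 ≤ M₀ := (apply_nonneg _ _).trans (hM₀ τ (Ioo_subset_Icc_self hmem)).1
  have hM₁' : 0 ≤ M₁ := (apply_nonneg _ _).trans (hM₁ τ (Ioo_subset_Icc_self hmem)).1
  have hFv : ∀ σ, 0 < σ → v σ = F σ := fun σ hσ => funext fun y => (hF σ hσ y).symm
  have hderiv : ∀ σ ∈ Ioo (τ / 2) (2 * τ), ∀ x, HasDerivAt (fun σ => F σ x) (G σ x) σ := by
    intro σ hσ x
    have hopen : IsOpen ((univ : Set (Spc n)) ×ˢ Ioi (0 : ℝ)) := isOpen_univ.prod isOpen_Ioi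
    have hd : DifferentiableAt ℝ (fun q : Spc n × ℝ => v q.2 q.1) (x, σ) :=
      (hsmooth.contDiffAt (hopen.mem_nhds (mk_mem_prod (mem_univ x) (hpos' σ hσ)))).differentiableAt
        (by simp)
    have hd' : DifferentiableAt ℝ (fun σ => v σ x) σ :=
      hd.comp σ ((differentiableAt_const x).prodMk differentiableAt_id)
    rw [hG σ (hpos' σ hσ) x]
    refine hd'.hasDerivAt.congr_of_eventuallyEq ?_
    filter_upwards [Ioi_mem_nhds (hpos' σ hσ)] with t ht using hF t ht x
  have hE := hasDerivAt_entropyE hn hs0 hns β (C := 2 ^ (n + 2) * (M₀ + M₁)) isOpen_Ioo hmem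
    (by positivity)
    (fun σ hσ => hdecay _ (hM₀ σ (Ioo_subset_Icc_self hσ)).1 (hM₁ σ (Ioo_subset_Icc_self hσ)).1)
    (fun σ hσ => hdecay _ (hM₀ σ (Ioo_subset_Icc_self hσ)).2 (hM₁ σ (Ioo_subset_Icc_self hσ)).2)
    hderiv
  have hΦ : Function.HasTemperateGrowth fun z => Ks n s (F τ) z + β / 2 * ‖z‖ ^ 2 :=
    ((F τ).hasTemperateGrowth_Ks hn hs0 hns).fun_add
      ((Function.HasTemperateGrowth.const _).mul (Function.hasTemperateGrowth_norm_sq (Spc n)))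
  refine (hE.congr_deriv ?_).congr_of_eventuallyEq ?_
  · rw [entropyI, hFv τ hτ, ← (F τ).integral_divergence_mul_eq_neg hΦ]
    refine integral_congr_ae (.of_forall fun y => ?_)
    simp only [hG τ hτ, hsol τ hτ y, hFv τ hτ, fpField,
      (F τ).gradient_Ks_add_norm_sq hn hs0 hns β]
    rfl
  · filter_upwards [Ioi_mem_nhds hτ] with σ hσ
    rw [hFv σ hσ]
end
end

section
/- Let c₀ > 0, Q(x) = −|x|²/2, Φ = Q + c₀, and let P₀ be the minimal-supersolution solution of the fractional obstacle problem with obstacle Φ. Then P₀ − Q is convex on ℝⁿ; equivalently, for every x ∈ ℝⁿ, every unit vector e and every h > 0, the second-difference inequality P₀(x+he) + P₀(x−he) − 2P₀(x) ≥ −h² holds (i.e. D_{ee} P₀ ≥ −1 in the sense of second differences). -/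
open MeasureTheory Real Set Filter
open scoped RealInnerProductSpace

noncomputable section

/-- A normalizing constant for the fractional Laplacian `(−Δ)^s`. -/
def fracLapConst (n : ℕ) (s : ℝ) : ℝ :=
  4 ^ s * Real.Gamma ((n : ℝ) / 2 + s) / (Real.pi ^ ((n : ℝ) / 2) * |Real.Gamma (-s)|)

/-- The fractional Laplacian `L_s = (−Δ)^s`, given by the symmetric singular integral
`(L_s p)(x) = (C(n,s)/2) ∫ (2p(x) − p(x+z) − p(x−z)) |z|^{−n−2s} dz`. -/
def Ls (n : ℕ) (s : ℝ) (p : Spc n → ℝ) (x : Spc n) : ℝ :=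
  (fracLapConst n s / 2) *
    ∫ z : Spc n, (2 * p x - p (x + z) - p (x - z)) * ‖z‖ ^ (-(n : ℝ) - 2 * s)

/-- `p` is `C¹` with locally `s`-Hölder continuous gradient (class `C^{1,s}`). -/
def C1HolderGrad (n : ℕ) (s : ℝ) (p : Spc n → ℝ) : Prop :=
  ContDiff ℝ 1 p ∧
  ∀ K : Set (Spc n), IsCompact K → ∃ M : ℝ, ∀ x ∈ K, ∀ y ∈ K,
    ‖gradient p x - gradient p y‖ ≤ M * ‖x - y‖ ^ s

/-- A global supersolution of the fractional obstacle problem lying above the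
obstacle `Φ`: bounded, nonnegative, `C¹` with locally `s`-Hölder gradient, `γ ≥ Φ`
and `L_s γ ≥ 0` pointwise. -/
def IsSupersol (n : ℕ) (s : ℝ) (Φ γ : Spc n → ℝ) : Prop :=
  (∃ M : ℝ, ∀ x, |γ x| ≤ M) ∧ (∀ x, 0 ≤ γ x) ∧ C1HolderGrad n s γ ∧
  (∀ x, Φ x ≤ γ x) ∧ (∀ x, 0 ≤ Ls n s γ x)

/-- The minimal-supersolution solution of the fractional obstacle problem with
obstacle `Φ`: a supersolution tending to `0` at infinity and lying below every
supersolution. -/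
def IsMinimalSupersol (n : ℕ) (s : ℝ) (Φ P₀ : Spc n → ℝ) : Prop :=
  IsSupersol n s Φ P₀ ∧ Filter.Tendsto P₀ (Filter.cocompact (Spc n)) (nhds 0) ∧
  ∀ γ : Spc n → ℝ, IsSupersol n s Φ γ → ∀ x, P₀ x ≤ γ x

lemma norm_gradient_sub_gradient {E : Type*} [NormedAddCommGroup E] [InnerProductSpace ℝ E]
    [CompleteSpace E] (p : E → ℝ) (x y : E) :
    ‖gradient p x - gradient p y‖ = ‖fderiv ℝ p x - fderiv ℝ p y‖ := by
  rw [gradient, gradient, ← map_sub, LinearIsometryEquiv.norm_map]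

/-- The weighted average of two translates of `p`, raised by a constant. -/
def translateAverage {E : Type*} [Add E] (p : E → ℝ) (a b c : ℝ) (u w : E) (x : E) : ℝ :=
  a * p (x + u) + b * p (x + w) + c

lemma C1HolderGrad.translateAverage {n : ℕ} {s : ℝ} {p : Spc n → ℝ} (hp : C1HolderGrad n s p)
    {a b : ℝ} (ha : 0 ≤ a) (hb : 0 ≤ b) (c : ℝ) (u w : Spc n) :
    C1HolderGrad n s (translateAverage p a b c u w) := by
  obtain ⟨hp1, hp2⟩ := hp
  have hd : ∀ x, HasFDerivAt p (fderiv ℝ p x) x := fun x =>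
    (hp1.differentiable one_ne_zero x).hasFDerivAt
  have hfd : ∀ x, fderiv ℝ (_root_.translateAverage p a b c u w) x =
      a • fderiv ℝ p (x + u) + b • fderiv ℝ p (x + w) := fun x =>
    (((((hasFDerivAt_comp_add_right u).2 (hd (x + u))).const_mul a).add
      (((hasFDerivAt_comp_add_right w).2 (hd (x + w))).const_mul b)).add_const c).fderiv
  refine ⟨?_, fun K hK => ?_⟩
  · unfold _root_.translateAverage
    fun_prop
  · obtain ⟨M₁, h₁⟩ := hp2 _ (hK.image (continuous_add_const u))
    obtain ⟨M₂, h₂⟩ := hp2 _ (hK.image (continuous_add_const w))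
    refine ⟨a * M₁ + b * M₂, fun x hx y hy => ?_⟩
    have e₁ := h₁ _ (mem_image_of_mem _ hx) _ (mem_image_of_mem _ hy)
    have e₂ := h₂ _ (mem_image_of_mem _ hx) _ (mem_image_of_mem _ hy)
    rw [norm_gradient_sub_gradient, add_sub_add_right_eq_sub] at e₁ e₂
    rw [norm_gradient_sub_gradient, hfd, hfd]
    calc _ = ‖a • (fderiv ℝ p (x + u) - fderiv ℝ p (y + u)) +
          b • (fderiv ℝ p (x + w) - fderiv ℝ p (y + w))‖ := by
            congr 1; simp only [smul_sub]; abel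
      _ ≤ a * ‖fderiv ℝ p (x + u) - fderiv ℝ p (y + u)‖ +
          b * ‖fderiv ℝ p (x + w) - fderiv ℝ p (y + w)‖ := by
            refine (norm_add_le _ _).trans_eq ?_
            rw [norm_smul, norm_smul, Real.norm_of_nonneg ha, Real.norm_of_nonneg hb]
      _ ≤ a * (M₁ * ‖x - y‖ ^ s) + b * (M₂ * ‖x - y‖ ^ s) := by gcongr
      _ = _ := by ring

/-- Second differences of a function with locally `s`-Hölder gradient are `O(|z|^(1+s))`. -/
lemma C1HolderGrad.exists_second_difference_le {n : ℕ} {s : ℝ} (hs : 0 ≤ s) {p : Spc n → ℝ}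
    (hp : C1HolderGrad n s p) (x : Spc n) :
    ∃ C : ℝ, 0 ≤ C ∧ ∀ z, ‖z‖ ≤ 1 → |2 * p x - p (x + z) - p (x - z)| ≤ C * ‖z‖ ^ s * ‖z‖ := by
  obtain ⟨hp1, hp2⟩ := hp
  have hd : ∀ y, HasFDerivAt p (fderiv ℝ p y) y := fun y =>
    (hp1.differentiable one_ne_zero y).hasFDerivAt
  obtain ⟨M, hM⟩ := hp2 _ (isCompact_closedBall x 1)
  refine ⟨|M| * 2 ^ s, by positivity, fun z hz => ?_⟩
  have key := Convex.norm_image_sub_le_of_norm_hasFDerivWithin_le (𝕜 := ℝ)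
    (f := fun y => p (x + y) + p (x - y)) (f' := fun y => fderiv ℝ p (x + y) - fderiv ℝ p (x - y))
    (s := Metric.closedBall 0 ‖z‖) (x := 0) (y := z) (C := |M| * 2 ^ s * ‖z‖ ^ s)
    (fun y _ => by
      have h₁ := (hasFDerivAt_comp_add_left (f := p) x).2 (hd (x + y))
      have h₂ := (hd (x - y)).comp y ((hasFDerivAt_id y).const_sub x)
      rw [ContinuousLinearMap.comp_neg, ContinuousLinearMap.comp_id] at h₂
      rw [sub_eq_add_neg (fderiv ℝ p (x + y))]
      exact (h₁.add h₂).hasFDerivWithinAt)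
    (fun y hy => by
      have hy' : ‖y‖ ≤ ‖z‖ := by simpa using hy
      have := hM (x + y) (by simpa using hy'.trans hz) (x - y) (by simpa using hy'.trans hz)
      rw [norm_gradient_sub_gradient] at this
      refine this.trans ?_
      have hxy : ‖x + y - (x - y)‖ = 2 * ‖y‖ := by
        rw [show x + y - (x - y) = (2 : ℝ) • y by rw [two_smul]; abel, norm_smul]
        simp
      rw [hxy, Real.mul_rpow zero_le_two (norm_nonneg y), ← mul_assoc]
      gcongr
      exact le_abs_self M)
    (convex_closedBall _ _) (by simp) (by simp)
  simp only [add_zero, sub_zero, Real.norm_eq_abs] at key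
  refine (le_of_eq ?_).trans key
  rw [← abs_neg]
  congr 1
  ring

lemma C1HolderGrad.integrable_second_difference {n : ℕ} {s : ℝ} (hn : 1 ≤ n) (hs0 : 0 < s)
    (hs1 : s < 1) {p : Spc n → ℝ} (hp : C1HolderGrad n s p) (hb : ∃ M : ℝ, ∀ x, |p x| ≤ M)
    (x : Spc n) :
    Integrable fun z : Spc n =>
      (2 * p x - p (x + z) - p (x - z)) * ‖z‖ ^ (-(n : ℝ) - 2 * s) := by
  obtain ⟨M, hM⟩ := hb
  obtain ⟨C, hC0, hC⟩ := hp.exists_second_difference_le hs0.le x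
  have hpc : Continuous p := hp.1.continuous
  have hmeas : Measurable fun z : Spc n =>
      (2 * p x - p (x + z) - p (x - z)) * ‖z‖ ^ (-(n : ℝ) - 2 * s) := by
    refine Measurable.mul ?_ (by fun_prop)
    exact Continuous.measurable (by fun_prop)
  rw [← integrableOn_univ, ← union_compl_self (Metric.ball (0 : Spc n) 1)]
  refine IntegrableOn.union ?_ ?_
  · refine integrableOn_ball_of_norm_le_rpow (C := C) (α := n + s - 1) (by simpa using hn)
      (by rw [finrank_euclideanSpace_fin]; linarith) ?_ hmeas.aestronglyMeasurable
    filter_upwards [ae_restrict_mem measurableSet_ball] with z hz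
    rcases eq_or_ne z 0 with rfl | hz0
    · have : 2 * p x - p x - p x = 0 := by ring
      simp only [add_zero, sub_zero, this, zero_mul, norm_zero]
      positivity
    · have hz' : 0 < ‖z‖ := norm_pos_iff.2 hz0
      have hz1 : ‖z‖ ≤ 1 := by simpa using (mem_ball_zero_iff.1 hz).le
      rw [norm_mul, Real.norm_eq_abs, Real.norm_of_nonneg (by positivity : 0 ≤ ‖z‖ ^ (_ : ℝ))]
      calc _ ≤ C * ‖z‖ ^ s * ‖z‖ * ‖z‖ ^ (-(n : ℝ) - 2 * s) := by gcongr; exact hC z hz1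
        _ = C * (‖z‖ ^ s * ‖z‖ ^ (1 : ℝ) * ‖z‖ ^ (-(n : ℝ) - 2 * s)) := by
          rw [Real.rpow_one]; ring
        _ = _ := by
          rw [← Real.rpow_add hz', ← Real.rpow_add hz']
          congr 2
          ring
  · have hfin : (Module.finrank ℝ (Spc n) : ℝ) < n + 2 * s := by simpa using hs0
    refine Integrable.mono'
      ((integrable_one_add_norm hfin).const_mul (4 * M * 2 ^ ((n : ℝ) + 2 * s))).integrableOn
      hmeas.aestronglyMeasurable ?_
    filter_upwards [ae_restrict_mem measurableSet_ball.compl] with z hz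
    have hz1 : 1 ≤ ‖z‖ := by simpa using hz
    have hM0 : 0 ≤ M := (abs_nonneg _).trans (hM 0)
    have hd : |2 * p x - p (x + z) - p (x - z)| ≤ 4 * M := by
      have h₁ := abs_le.1 (hM x)
      have h₂ := abs_le.1 (hM (x + z))
      have h₃ := abs_le.1 (hM (x - z))
      exact abs_le.2 ⟨by linarith, by linarith⟩
    rw [norm_mul, Real.norm_eq_abs, Real.norm_of_nonneg (by positivity : 0 ≤ ‖z‖ ^ (_ : ℝ)),
      mul_assoc]
    gcongr
    calc ‖z‖ ^ (-(n : ℝ) - 2 * s) = 2 ^ ((n : ℝ) + 2 * s) * (2 * ‖z‖) ^ (-((n : ℝ) + 2 * s)) := by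
          rw [Real.mul_rpow zero_le_two (norm_nonneg z), ← mul_assoc,
            ← Real.rpow_add zero_lt_two, add_neg_cancel, Real.rpow_zero, one_mul]
          congr 1
          ring
      _ ≤ _ := by
          gcongr 2 ^ _ * ?_
          exact Real.rpow_le_rpow_of_nonpos (by positivity) (by linarith)
            (neg_nonpos.2 (by positivity))

lemma Ls_translateAverage {n : ℕ} {s : ℝ} (hn : 1 ≤ n) (hs0 : 0 < s) (hs1 : s < 1)
    {p : Spc n → ℝ} (hp : C1HolderGrad n s p) (hb : ∃ M : ℝ, ∀ x, |p x| ≤ M)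
    (a b c : ℝ) (u w x : Spc n) :
    Ls n s (translateAverage p a b c u w) x = a * Ls n s p (x + u) + b * Ls n s p (x + w) := by
  have h₁ := (hp.integrable_second_difference hn hs0 hs1 hb (x + u)).const_mul a
  have h₂ := (hp.integrable_second_difference hn hs0 hs1 hb (x + w)).const_mul b
  have h := integral_add h₁ h₂
  rw [integral_const_mul, integral_const_mul] at h
  unfold Ls
  calc _ = fracLapConst n s / 2 * _ := congrArg _ ((integral_congr_ae (.of_forall fun z => by
        simp only [translateAverage, add_right_comm x _ z, sub_eq_add_neg,
          add_right_comm x _ (-z)]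
        ring)).trans h)
    _ = _ := by ring

/-- A minimal supersolution lies below those averages of its translates that lie above the
obstacle. -/
lemma IsMinimalSupersol.le_translateAverage {n : ℕ} {s : ℝ} (hn : 1 ≤ n) (hs0 : 0 < s)
    (hs1 : s < 1) {Φ P : Spc n → ℝ} (hP : IsMinimalSupersol n s Φ P) {a b c : ℝ} (ha : 0 ≤ a)
    (hb : 0 ≤ b) (hc : 0 ≤ c) {u w : Spc n}
    (hΦ : ∀ x, Φ x ≤ translateAverage Φ a b c u w x) (x : Spc n) :
    P x ≤ translateAverage P a b c u w x := by
  obtain ⟨⟨hbd, hnn, hreg, hobs, hL⟩, -, hmin⟩ := hP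
  refine hmin _ ⟨?_, fun y => ?_, hreg.translateAverage ha hb c u w, fun y => (hΦ y).trans ?_,
    fun y => ?_⟩ x
  · obtain ⟨M, hM⟩ := hbd
    refine ⟨a * M + b * M + c, fun y => ?_⟩
    have hu := abs_le.1 (hM (y + u))
    have hw := abs_le.1 (hM (y + w))
    unfold translateAverage
    rw [abs_of_nonneg (add_nonneg (add_nonneg (mul_nonneg ha (hnn _)) (mul_nonneg hb (hnn _))) hc)]
    gcongr
    exacts [hu.2, hw.2]
  · exact add_nonneg (add_nonneg (mul_nonneg ha (hnn _)) (mul_nonneg hb (hnn _))) hc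
  · unfold translateAverage
    gcongr
    exacts [hobs _, hobs _]
  · rw [Ls_translateAverage hn hs0 hs1 hreg hbd]
    exact add_nonneg (mul_nonneg ha (hL _)) (mul_nonneg hb (hL _))

/-- Jensen defect of the squared norm, for translations with barycentre `0`. -/
lemma mul_norm_add_sq_add_mul_norm_add_sq {E : Type*} [NormedAddCommGroup E]
    [InnerProductSpace ℝ E] {a b : ℝ} (hab : a + b = 1) {u w : E} (huw : a • u + b • w = 0)
    (x : E) :
    a * ‖x + u‖ ^ 2 + b * ‖x + w‖ ^ 2 = ‖x‖ ^ 2 + (a * ‖u‖ ^ 2 + b * ‖w‖ ^ 2) := by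
  have h : a * ⟪x, u⟫ + b * ⟪x, w⟫ = 0 := by
    rw [← real_inner_smul_right, ← real_inner_smul_right, ← inner_add_right, huw, inner_zero_right]
  rw [norm_add_sq_real, norm_add_sq_real]
  linear_combination 2 * h + ‖x‖ ^ 2 * hab

/-- Lemma 6.4, semiconvexity: if `P₀` is the minimal-supersolution
solution of the obstacle problem with obstacle `Φ = Q + c₀`, `Q(x) = −|x|²/2`, then
`P₀ − Q` is convex; equivalently `P₀(x+he) + P₀(x−he) − 2P₀(x) ≥ −h²` for every unit
vector `e` and `h > 0`. -/
theorem obstacle_solution_semiconvex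
    (n : ℕ) (s : ℝ) (hn : 1 ≤ n) (hs0 : 0 < s) (hs1 : s < 1) (hns : 2 * s < (n : ℝ))
    (c₀ : ℝ) (hc₀ : 0 < c₀) (P₀ : Spc n → ℝ)
    (hP₀ : IsMinimalSupersol n s (fun x : Spc n => -‖x‖ ^ 2 / 2 + c₀) P₀) :
    ConvexOn ℝ Set.univ (fun x : Spc n => P₀ x + ‖x‖ ^ 2 / 2) ∧
    (∀ x : Spc n, ∀ e : Spc n, ‖e‖ = 1 → ∀ h : ℝ, 0 < h →
      P₀ (x + h • e) + P₀ (x - h • e) - 2 * P₀ x ≥ -h ^ 2) := by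
  have key : ∀ (a b : ℝ) (u w x : Spc n), 0 ≤ a → 0 ≤ b → a + b = 1 → a • u + b • w = 0 →
      P₀ x ≤ a * P₀ (x + u) + b * P₀ (x + w) + (a * ‖u‖ ^ 2 + b * ‖w‖ ^ 2) / 2 := by
    intro a b u w x ha hb hab huw
    refine hP₀.le_translateAverage hn hs0 hs1 ha hb (by positivity) (fun y => le_of_eq ?_) x
    have h := mul_norm_add_sq_add_mul_norm_add_sq hab huw y
    simp only [translateAverage]
    linear_combination h / 2 - c₀ * hab
  refine ⟨⟨convex_univ, fun x _ y _ a b ha hb hab => ?_⟩, fun x e he h _ => ?_⟩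
  · set m := a • x + b • y with hm
    have huw : a • (x - m) + b • (y - m) = 0 := by
      rw [smul_sub, smul_sub, sub_add_sub_comm, ← add_smul, hab, one_smul, ← hm, sub_self]
    have h₁ := key a b (x - m) (y - m) m ha hb hab huw
    have h₂ := mul_norm_add_sq_add_mul_norm_add_sq hab huw m
    rw [add_sub_cancel, add_sub_cancel] at h₁ h₂
    simp only [smul_eq_mul]
    linarith
  · have h₁ := key (1 / 2) (1 / 2) (h • e) (-(h • e)) x (by norm_num) (by norm_num) (by norm_num)
      (by rw [smul_neg, add_neg_cancel])
    rw [norm_neg, norm_smul, he, mul_one, Real.norm_eq_abs, sq_abs, ← sub_eq_add_neg] at h₁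
    linarith
end
end
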